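/- arXiv:2302.08699 — 11 statements merged into one kernel-verified Lean document; each statement's English description precedes it below -/
import Mathlib

section
/- Let R be a bisection structure on a finite set X. For distinct x, z ∈ X, let P(x,z) denote the set of y ∈ X \ {x,z} such that R_y(x,z) fails. Then for any y ∈ P(x,z), one has P(x,z) = P(x,y) ∪ {y} ∪ P(y,z). -/
/-- A bisection structure on `X`: a rule assigning to each `x : X` an equivalence
relation `R x` on `X \ {x}` (encoded as a relation on `X` that is `False` whenever
an argument equals `x`) with at most two equivalence classes, such that for any
three distinct elements at most one of `R x y z`, `R y x z`, `R z x y` fails. -/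
structure IsBisection {X : Type} (R : X → X → X → Prop) : Prop where
  dom : ∀ x y z, R x y z → y ≠ x ∧ z ≠ x
  refl : ∀ x y, y ≠ x → R x y y
  symm : ∀ x y z, R x y z → R x z y
  trans : ∀ x y z w, R x y z → R x z w → R x y w
  two_classes : ∀ x y z w, y ≠ x → z ≠ x → w ≠ x → (R x y z ∨ R x y w ∨ R x z w)
  tripod : ∀ x y z, x ≠ y → y ≠ z → x ≠ z →
    ((R x y z ∧ R y x z) ∨ (R x y z ∧ R z x y) ∨ (R y x z ∧ R z x y))

/-- For distinct `x, z`, the set `P(x,z)` of elements `y ∉ {x,z}` such that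
`R y x z` fails, i.e. the elements "between" `x` and `z`. -/
def Pset {X : Type} (R : X → X → X → Prop) (x z : X) : Set X :=
  {y | y ≠ x ∧ y ≠ z ∧ ¬ R y x z}

/-- If `y` separates `x` and `z`, then `x` does not separate `y` and `z`. -/
theorem IsBisection.rel_of_not_rel {X : Type} {R : X → X → X → Prop} (hR : IsBisection R)
    {x y z : X} (hyx : y ≠ x) (hyz : y ≠ z) (hxz : x ≠ z) (h : ¬ R y x z) : R x y z := by
  have := hR.tripod x y z hyx.symm hyz hxz
  tauto

theorem Pset_comm {X : Type} {R : X → X → X → Prop} (hR : IsBisection R) (x z : X) :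
    Pset R x z = Pset R z x := by
  ext y
  have h : R y x z ↔ R y z x := ⟨hR.symm y x z, hR.symm y z x⟩
  simp only [Pset, Set.mem_ofPred_eq, h]
  tauto

theorem Pset_subset_of_mem {X : Type} {R : X → X → X → Prop} (hR : IsBisection R)
    {x y z : X} (hxz : x ≠ z) (hy : y ∈ Pset R x z) : Pset R x y ⊆ Pset R x z := by
  obtain ⟨hyx, hyz, hyR⟩ := hy
  rintro w ⟨hwx, hwy, hwR⟩
  have hwyx : ¬ R w y x := fun h => hwR (hR.symm _ _ _ h)
  have hwz : w ≠ z := by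
    rintro rfl
    exact hyR (hR.symm _ _ _ (hR.rel_of_not_rel hwy hwx hyx hwyx))
  refine ⟨hwx, hwz, fun hxzR => hyR ?_⟩
  have hwyz : ¬ R w y z := fun h =>
    hwR (hR.trans _ _ _ _ hxzR (hR.symm _ _ _ h))
  exact hR.trans _ _ _ _ (hR.symm _ _ _ (hR.rel_of_not_rel hwy hwx hyx hwyx))
    (hR.rel_of_not_rel hwy hwz hyz hwyz)

/-- For a bisection structure `R` on a finite set `X`, distinct
`x, z`, and any `y ∈ P(x,z)`, one has `P(x,z) = P(x,y) ∪ {y} ∪ P(y,z)`. -/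
theorem Pset_eq_union {X : Type} [Fintype X] (R : X → X → X → Prop)
    (hR : IsBisection R) (x z y : X) (hxz : x ≠ z) (hy : y ∈ Pset R x z) :
    Pset R x z = Pset R x y ∪ {y} ∪ Pset R y z := by
  apply Set.Subset.antisymm
  · rintro w ⟨hwx, hwz, hwR⟩
    by_cases hwy : w = y
    · exact Or.inl (Or.inr hwy)
    by_cases h : R w x y
    · exact Or.inr ⟨hwy, hwz, fun h' => hwR (hR.trans _ _ _ _ h h')⟩
    · exact Or.inl (Or.inl ⟨hwx, hwy, h⟩)
  · refine Set.union_subset (Set.union_subset (Pset_subset_of_mem hR hxz hy)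
      (Set.singleton_subset_iff.mpr hy)) ?_
    rw [Pset_comm hR y z, Pset_comm hR x z]
    exact Pset_subset_of_mem hR hxz.symm (Pset_comm hR x z ▸ hy)
end

section
/- Let S be an oriented bisection structure on a set X. Call distinct elements x, y ∈ X adjacent if for every z ∈ X \ {x,y} one has S(z,x) = S(z,y). Define a relation ∼ on X × {0,1} by declaring (x,a) ∼ (y,b) if either (x,a) = (y,b), or x ≠ y, x and y are adjacent, S(y,x) = b, and S(x,y) = a. Then ∼ is an equivalence relation on X × {0,1}. -/
/-- An oriented bisection structure on `X`: a function `S : X × X → {0,1}`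
(encoded as an `ℕ`-valued function taking only the values `0` and `1`) with
`S x x = 0`, such that for any three distinct `x, y, z` at most one of the
equalities `S x y = S x z`, `S y x = S y z`, `S z x = S z y` fails. -/
def IsOrientedBisection {X : Type} (S : X → X → ℕ) : Prop :=
  (∀ a b, S a b = 0 ∨ S a b = 1) ∧ (∀ a, S a a = 0) ∧
  ∀ x y z : X, x ≠ y → y ≠ z → x ≠ z →
    ((S x y = S x z ∧ S y x = S y z) ∨ (S x y = S x z ∧ S z x = S z y) ∨
      (S y x = S y z ∧ S z x = S z y))

/-- Two distinct elements `x, y` are adjacent if every `z ∉ {x,y}` satisfies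
`S z x = S z y`. -/
def AdjacentOBS {X : Type} (S : X → X → ℕ) (x y : X) : Prop :=
  ∀ z : X, z ≠ x → z ≠ y → S z x = S z y

/-- The relation `∼` on `X × {0,1}`: `(x,a) ∼ (y,b)` iff `(x,a) = (y,b)`, or
`x ≠ y` are adjacent, `S y x = b` and `S x y = a`. -/
def simRel {X : Type} (S : X → X → ℕ) (p q : X × Fin 2) : Prop :=
  p = q ∨ (p.1 ≠ q.1 ∧ AdjacentOBS S p.1 q.1 ∧
    S q.1 p.1 = (q.2 : ℕ) ∧ S p.1 q.1 = (p.2 : ℕ))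

/-- For an oriented bisection structure `S` on `X`, the relation
`∼` is an equivalence relation on `X × {0,1}`. -/
theorem simRel_equivalence {X : Type} (S : X → X → ℕ)
    (hS : IsOrientedBisection S) : Equivalence (simRel S) := by
  refine ⟨fun _ => Or.inl rfl, ?_, ?_⟩
  · rintro p q (h | ⟨hne, hadj, hqp, hpq⟩)
    · exact Or.inl h.symm
    · exact Or.inr ⟨hne.symm, fun z hzq hzp => (hadj z hzp hzq).symm, hpq, hqp⟩
  · rintro ⟨x, a⟩ ⟨y, b⟩ ⟨z, c⟩ (h | ⟨hxy, adjxy, hyx, hxy'⟩) (h' | ⟨hyz, adjyz, hzy, hyz'⟩)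
    · exact Or.inl (h.trans h')
    · rw [h]
      exact Or.inr ⟨hyz, adjyz, hzy, hyz'⟩
    · rw [← h']
      exact Or.inr ⟨hxy, adjxy, hyx, hxy'⟩
    · dsimp only at *
      by_cases hxz : x = z
      · subst hxz
        exact Or.inl (Prod.ext rfl (Fin.ext (hxy'.symm.trans hzy)))
      · refine Or.inr ⟨hxz, fun w hwx hwz => ?_, ?_, ?_⟩
        · by_cases hwy : w = y
          · subst hwy
            exact hyx.trans hyz'.symm
          · exact (adjxy w hwx hwy).trans (adjyz w hwy hwz)
        · exact (adjxy z (Ne.symm hxz) hyz.symm).trans hzy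
        · exact (adjyz x hxy hxz).symm.trans hxy'
end

section
/- Let X be a finite set with n elements, where n ≥ 2. Then the number of bisection structures on X equals (n+1)^{n-2}. -/
/-- A strict order on `X` in which the elements above any given element form a chain; on a finite
type this is the ancestor relation `lt x y` (`y` is a proper ancestor of `x`) of a rooted forest. -/
structure IsForest {X : Type} (lt : X → X → Prop) : Prop where
  irrefl : ∀ x, ¬ lt x x
  trans : ∀ x y z, lt x y → lt y z → lt x z
  chain : ∀ x y z, lt x y → lt x z → y = z ∨ lt y z ∨ lt z y

namespace IsForest

variable {X : Type} {lt : X → X → Prop}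

/-- The maximal elements of a relation. -/
def IsRoot (lt : X → X → Prop) (x : X) : Prop := ∀ y, ¬ lt x y

/-- Hang the tree below the root `x` under the vertex `z`. -/
def attach (lt : X → X → Prop) (x z a b : X) : Prop :=
  lt a b ∨ ((a = x ∨ lt a x) ∧ (z = b ∨ lt z b))

/-- Cut the tree below `x` from the forest, making `x` a root. -/
def detach (lt : X → X → Prop) (x a b : X) : Prop :=
  lt a b ∧ ¬ ((a = x ∨ lt a x) ∧ lt x b)

lemma wellFounded_flip [Finite X] (h : IsForest lt) : WellFounded (fun a b => lt b a) :=
  haveI : IsTrans X (fun a b => lt b a) := ⟨fun a b c hab hbc => h.trans c b a hbc hab⟩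
  haveI : Std.Irrefl (fun a b => lt b a) := ⟨h.irrefl⟩
  Finite.wellFounded_of_trans_of_irrefl _

lemma wellFounded [Finite X] (h : IsForest lt) : WellFounded lt :=
  haveI : IsTrans X lt := ⟨h.trans⟩
  haveI : Std.Irrefl lt := ⟨h.irrefl⟩
  Finite.wellFounded_of_trans_of_irrefl _

lemma exists_root [Finite X] (h : IsForest lt) (z : X) :
    ∃ r, IsRoot lt r ∧ (z = r ∨ lt z r) := by
  obtain ⟨r, hr, hmin⟩ := h.wellFounded_flip.has_min {r | z = r ∨ lt z r} ⟨z, Or.inl rfl⟩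
  refine ⟨r, fun y hy => hmin y ?_ hy, hr⟩
  rcases hr with rfl | hr
  · exact Or.inr hy
  · exact Or.inr (h.trans _ _ _ hr hy)

lemma exists_parent [Finite X] (h : IsForest lt) {x : X} (hx : ¬ IsRoot lt x) :
    ∃ z, ∀ b, lt x b ↔ z = b ∨ lt z b := by
  simp only [IsRoot, not_forall, not_not] at hx
  obtain ⟨z, hz, hmin⟩ := h.wellFounded.has_min {z | lt x z} hx
  refine ⟨z, fun b => ⟨fun hb => ?_, ?_⟩⟩
  · have h1 := h.chain x z b hz hb
    have h2 := hmin b hb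
    tauto
  · rintro (rfl | hb)
    · exact hz
    · exact h.trans _ _ _ hz hb

lemma isForest_attach (h : IsForest lt) {x z : X} (hx : IsRoot lt x) (hz : ¬ (z = x ∨ lt z x)) :
    IsForest (attach lt x z) := by
  obtain ⟨h1, h2, h3⟩ := h
  unfold IsRoot at hx
  constructor
  · unfold attach; grind
  · unfold attach; grind
  · unfold attach; grind

lemma isForest_detach (h : IsForest lt) (x : X) : IsForest (detach lt x) := by
  obtain ⟨h1, h2, h3⟩ := h
  constructor
  · unfold detach; grind
  · unfold detach; grind
  · unfold detach; grind

lemma isRoot_attach_iff (x z r : X) :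
    IsRoot (attach lt x z) r ↔ IsRoot lt r ∧ r ≠ x := by
  refine ⟨fun h => ⟨fun y hy => h y (Or.inl hy),
    fun e => h z (Or.inr ⟨Or.inl e, Or.inl rfl⟩)⟩, ?_⟩
  rintro ⟨h, hne⟩ y (hy | ⟨hy | hy, -⟩)
  exacts [h y hy, hne hy, h x hy]

lemma isRoot_detach_iff (h : IsForest lt) (x r : X) :
    IsRoot (detach lt x) r ↔ IsRoot lt r ∨ r = x := by
  obtain ⟨h1, h2, h3⟩ := h
  unfold IsRoot detach
  grind

lemma attach_detach (h : IsForest lt) {x z : X} (hz : ∀ b, lt x b ↔ z = b ∨ lt z b) :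
    attach (detach lt x) x z = lt := by
  obtain ⟨h1, h2, h3⟩ := h
  funext a b
  unfold attach detach
  grind

lemma detach_attach (h : IsForest lt) {x z : X} (hx : IsRoot lt x) (hz : ¬ (z = x ∨ lt z x)) :
    detach (attach lt x z) x = lt := by
  obtain ⟨h1, h2, h3⟩ := h
  funext a b
  unfold IsRoot at hx
  unfold attach detach
  grind

/-- The parent of `x` in `attach lt x z` is `z`. -/
lemma attach_self_iff {x z : X} (hx : IsRoot lt x) (b : X) :
    attach lt x z x b ↔ z = b ∨ lt z b := by
  have := hx b
  unfold attach
  tauto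

/-- The bisection structure whose classes at `x` are the descendants and the non-descendants
of `x`. -/
def bisection (lt : X → X → Prop) (x y z : X) : Prop := y ≠ x ∧ z ≠ x ∧ (lt y x ↔ lt z x)

lemma isBisection (h : IsForest lt) : IsBisection (bisection lt) := by
  obtain ⟨h1, h2, h3⟩ := h
  constructor <;> unfold bisection <;> grind

/-- The forest obtained by moving the root to the lower end of the edge `x`, if `o = some x`. -/
def reroot (lt : X → X → Prop) (o : Option X) (a b : X) : Prop :=
  a ≠ b ∧ (lt a b ↔ ¬ ∃ x ∈ o, x = b ∨ lt x b)

lemma isForest_reroot (h : IsForest lt) (o : Option X) : IsForest (reroot lt o) := by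
  obtain ⟨h1, h2, h3⟩ := h
  cases o <;> constructor <;> simp only [reroot, Option.mem_def, reduceCtorEq, Option.some.injEq,
    false_and, exists_false, exists_eq_left'] <;> grind

lemma bisection_reroot (o : Option X) : bisection (reroot lt o) = bisection lt := by
  funext x y z
  unfold bisection reroot
  grind

lemma reroot_injective [Nontrivial X] (h : IsForest lt) : Function.Injective (reroot lt) := by
  obtain ⟨h1, h2, h3⟩ := h
  intro o o' ho
  have key : ∀ b, (∃ x ∈ o, x = b ∨ lt x b) ↔ (∃ x ∈ o', x = b ∨ lt x b) := by
    intro b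
    obtain ⟨a, ha⟩ := exists_ne b
    have := congrFun (congrFun ho a) b
    simp only [reroot, ne_eq, ha, not_false_eq_true, true_and, eq_iff_iff] at this
    grind
  rcases o with _ | x <;> rcases o' with _ | x'
  · rfl
  · simpa using key x'
  · simpa using key x
  · have hx := key x
    have hx' := key x'
    simp only [Option.mem_def, Option.some.injEq, exists_eq_left'] at hx hx' ⊢
    grind

lemma exists_reroot_eq [Finite X] [Nontrivial X] {lt' : X → X → Prop} (h : IsForest lt)
    (h' : IsForest lt') (hb : bisection lt' = bisection lt) : ∃ o, reroot lt o = lt' := by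
  -- the two forests agree at `b`, or they are opposite at `b`
  have flip : ∀ b, (∀ a, a ≠ b → (lt' a b ↔ lt a b)) ∨ (∀ a, a ≠ b → (lt' a b ↔ ¬ lt a b)) := by
    intro b
    obtain ⟨c, hc⟩ := exists_ne b
    have hac : ∀ a, a ≠ b → ((lt' a b ↔ lt' c b) ↔ (lt a b ↔ lt c b)) := by
      intro a ha
      have := congrFun (congrFun (congrFun hb b) a) c
      simpa [bisection, ha, hc] using this
    by_cases hcc : lt' c b ↔ lt c b
    · left; intro a ha; have := hac a ha; tauto
    · right; intro a ha; have := hac a ha; tauto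
  by_cases hS : ∃ b, ∀ a, a ≠ b → (lt' a b ↔ ¬ lt a b)
  · obtain ⟨x, hx, hmin⟩ := h.wellFounded.has_min {b | ∀ a, a ≠ b → (lt' a b ↔ ¬ lt a b)} hS
    refine ⟨some x, ?_⟩
    simp only [Set.mem_ofPred_eq] at hx hmin
    obtain ⟨h1, h2, h3⟩ := h
    obtain ⟨h1', h2', h3'⟩ := h'
    funext a b
    simp only [reroot, Option.mem_def, Option.some.injEq, exists_eq_left', eq_iff_iff]
    by_cases hab : a = b
    · grind
    rcases flip b with hb | hb
    · by_cases hxb : x = b ∨ lt x b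
      · obtain rfl | hne := eq_or_ne x b
        · grind
        · have := hx b hne.symm
          have := hb x hne
          grind
      · grind
    · by_cases hxb : x = b ∨ lt x b
      · grind
      · have := hmin b hb
        have := hx b
        have := hb x
        grind
  · refine ⟨none, ?_⟩
    funext a b
    have h1 := h'.irrefl
    have hb := (flip b).resolve_right fun hb => hS ⟨b, hb⟩
    simp only [reroot, Option.mem_def, reduceCtorEq, false_and, exists_false, not_false_eq_true]
    grind

end IsForest

namespace IsBisection

variable {X : Type} {R : X → X → X → Prop}

lemma exists_forest [Nontrivial X] (h : IsBisection R) :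
    ∃ lt, IsForest lt ∧ IsForest.bisection lt = R := by
  obtain ⟨h1, h2, h3, h4, h5, h6⟩ := h
  obtain ⟨x₀, y₀, hxy⟩ := exists_pair_ne X
  refine ⟨fun a b => a ≠ b ∧ ((b = x₀ ∧ ¬ R b a y₀) ∨ (b ≠ x₀ ∧ ¬ R b a x₀)), ?_, ?_⟩
  · constructor
    · grind
    · intro x y z hxy hyz
      have hy : y ≠ x₀ := by grind
      have hxz : x ≠ z := by
        rintro rfl
        have := h6 x y x₀
        grind
      have t1 := h6 x y z hxy.1 hyz.1 hxz
      have t2 := h6 y z x₀ hyz.1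
      have t3 := h5 z x y
      by_cases hz : z = x₀
      · subst hz
        have := t3 y₀
        grind
      · have := t3 x₀
        grind
    · intro x y z hxy hxz
      by_cases hyz : y = z
      · exact Or.inl hyz
      have t := h6 x y z hxy.1 hyz hxz.1
      grind
  · funext x y z
    unfold IsForest.bisection
    by_cases hx : x = x₀
    · grind
    · grind

end IsBisection

namespace IsForest

open Finset

open scoped Classical in
/-- The roots of a forest on a finite type. -/
noncomputable def roots {X : Type} [Fintype X] (lt : X → X → Prop) : Finset X :=
  univ.filter (IsRoot lt)

open scoped Classical in
/-- The forests on `X` with exactly `k` roots. -/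
noncomputable def forests (X : Type) [Fintype X] (k : ℕ) : Finset (X → X → Prop) :=
  univ.filter fun lt => IsForest lt ∧ #(roots lt) = k

variable {X : Type} [Fintype X] {lt : X → X → Prop} {k : ℕ}

@[simp] lemma mem_roots {x : X} : x ∈ roots lt ↔ IsRoot lt x := by
  simp [roots]

@[simp] lemma mem_forests : lt ∈ forests X k ↔ IsForest lt ∧ #(roots lt) = k := by
  simp [forests]

open scoped Classical in
lemma roots_attach (x z : X) :
    roots (attach lt x z) = (roots lt).erase x := by
  ext r
  simp [isRoot_attach_iff, and_comm]

open scoped Classical in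
lemma roots_detach (h : IsForest lt) (x : X) : roots (detach lt x) = insert x (roots lt) := by
  ext r
  simp [isRoot_detach_iff h, or_comm]

open scoped Classical in
/-- Every vertex of a forest lies in the tree of all but one of the roots. -/
lemma card_roots_not_above (h : IsForest lt) (z : X) :
    #((roots lt).filter fun x => ¬ (z = x ∨ lt z x)) = #(roots lt) - 1 := by
  obtain ⟨r, hr, hzr⟩ := h.exists_root z
  rw [← card_erase_of_mem (mem_roots.2 hr)]
  congr 1
  ext x
  simp only [mem_filter, mem_roots, mem_erase]
  constructor
  · rintro ⟨hx, hzx⟩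
    exact ⟨fun e => hzx (e ▸ hzr), hx⟩
  · rintro ⟨hne, hx⟩
    refine ⟨hx, fun hzx => ?_⟩
    have := h.chain z r x
    have := hr x
    have := hx r
    grind

open scoped Classical in
/-- Double counting of the ways to hang one tree of a forest with `k + 1` roots under a vertex of
another tree. -/
lemma card_forests_mul (X : Type) [Fintype X] (k : ℕ) :
    #(forests X k) * (Fintype.card X - k) = #(forests X (k + 1)) * (Fintype.card X * k) := by
  have hA : #((forests X k).sigma fun lt => (roots lt)ᶜ) =
      #(forests X k) * (Fintype.card X - k) := by
    rw [card_sigma]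
    refine sum_const_nat fun lt hlt => ?_
    rw [card_compl, (mem_forests.1 hlt).2]
  have hB : #((forests X (k + 1)).sigma fun lt => (univ : Finset X).sigma fun z =>
      (roots lt).filter fun x => ¬ (z = x ∨ lt z x)) =
      #(forests X (k + 1)) * (Fintype.card X * k) := by
    rw [card_sigma]
    refine sum_const_nat fun lt hlt => ?_
    obtain ⟨h, hk⟩ := mem_forests.1 hlt
    rw [card_sigma]
    refine sum_const_nat fun z _ => ?_
    rw [card_roots_not_above h, hk, Nat.add_sub_cancel]
  rw [← hA, ← hB]
  symm
  refine card_bij (fun p _ => ⟨attach p.1 p.2.2 p.2.1, p.2.2⟩) ?_ ?_ ?_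
  · rintro ⟨lt, z, x⟩ hp
    simp only [mem_sigma, mem_forests, mem_univ, mem_filter, mem_roots, true_and] at hp
    obtain ⟨⟨h, hk⟩, hx, hzx⟩ := hp
    simp [isForest_attach h hx hzx, roots_attach,
      card_erase_of_mem (mem_roots.2 hx), hk]
  · rintro ⟨lt, z, x⟩ hp ⟨lt', z', x'⟩ hp' heq
    simp only [mem_sigma, mem_forests, mem_univ, mem_filter, mem_roots, true_and] at hp hp'
    obtain ⟨⟨h, -⟩, hx, hzx⟩ := hp
    obtain ⟨⟨h', -⟩, hx', hzx'⟩ := hp'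
    simp only [Sigma.mk.injEq, heq_eq_eq] at heq
    obtain ⟨heq, rfl⟩ := heq
    have hlt : lt = lt' := by
      rw [← detach_attach h hx hzx, heq, detach_attach h' hx' hzx']
    subst hlt
    have hz : z = z' := by
      have e1 := attach_self_iff (z := z) hx
      have e2 := attach_self_iff (z := z') hx
      rw [heq] at e1
      have h1 := h.irrefl
      have h2 := h.trans z z' z
      grind
    rw [hz]
  · rintro ⟨lt, x⟩ hp
    simp only [mem_sigma, mem_forests, mem_compl, mem_roots] at hp
    obtain ⟨⟨h, hk⟩, hx⟩ := hp
    obtain ⟨z, hz⟩ := h.exists_parent hx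
    refine ⟨⟨detach lt x, z, x⟩, ?_, ?_⟩
    · have hxz := (hz z).2 (Or.inl rfl)
      have h1 := h.irrefl
      have h2 := h.trans z x z
      simp only [mem_sigma, mem_forests, mem_univ, mem_filter, true_and,
        isForest_detach h, roots_detach h]
      rw [card_insert_of_notMem (by simpa using hx), hk]
      refine ⟨rfl, ?_⟩
      unfold detach
      grind
    · simp [attach_detach h hz]

lemma card_forests_self (X : Type) [Fintype X] : #(forests X (Fintype.card X)) = 1 := by
  rw [card_eq_one]
  refine ⟨fun _ _ => False, ?_⟩
  ext lt
  simp only [mem_forests, mem_singleton, card_eq_iff_eq_univ]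
  constructor
  · rintro ⟨-, hr⟩
    funext x y
    have hx : IsRoot lt x := mem_roots.1 (hr ▸ mem_univ x)
    simpa using hx y
  · rintro rfl
    exact ⟨⟨by simp, by simp, by simp⟩, by ext; simp [IsRoot]⟩

lemma card_forests {m k : ℕ} (hm : Fintype.card X = m + 1) (hk : k ≤ m) :
    #(forests X (k + 1)) = (m + 1) ^ (m - k) * m.choose k := by
  induction hk using Nat.decreasingInduction with
  | self => simp [← hm, card_forests_self]
  | of_succ j hj ih =>
    have hrec := card_forests_mul X (j + 1)
    rw [ih, hm] at hrec
    have hpos : 0 < m + 1 - (j + 1) := by omega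
    refine Nat.eq_of_mul_eq_mul_right hpos (hrec.trans ?_)
    obtain ⟨d, rfl⟩ : ∃ d, m = j + 1 + d := ⟨m - (j + 1), by omega⟩
    have hch := Nat.choose_succ_right_eq (j + 1 + d) j
    have e1 : j + 1 + d - (j + 1) = d := by omega
    have e2 : j + 1 + d - j = d + 1 := by omega
    have e3 : j + 1 + d + 1 - (j + 1) = d + 1 := by omega
    rw [e1, e2, e3]
    rw [e2] at hch
    calc _ = (j + 1 + d + 1) ^ (d + 1) * ((j + 1 + d).choose (j + 1) * (j + 1)) := by ring
      _ = _ := by rw [hch]; ring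

lemma forests_zero [Nonempty X] : forests X 0 = ∅ := by
  ext lt
  simp only [mem_forests, card_eq_zero, notMem_empty, iff_false, not_and]
  intro h hr
  obtain ⟨r, hr', -⟩ := h.exists_root (Classical.arbitrary X)
  simpa [hr] using mem_roots.2 hr'

open scoped Classical in
/-- Cayley's formula for rooted forests. -/
lemma card_filter_isForest {m : ℕ} (hm : Fintype.card X = m + 1) :
    #(univ.filter fun lt : X → X → Prop => IsForest lt) = (m + 2) ^ m := by
  have : Nonempty X := Fintype.card_pos_iff.1 (by omega)
  have hmaps : ∀ lt ∈ univ.filter (fun lt : X → X → Prop => IsForest lt),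
      #(roots lt) ∈ range (m + 2) := by
    intro lt _
    have := card_le_univ (roots lt)
    rw [mem_range]
    omega
  have hfib : ∀ k, (univ.filter fun lt : X → X → Prop => IsForest lt).filter
      (fun lt => #(roots lt) = k) = forests X k := by
    intro k
    ext lt
    simp
  rw [card_eq_sum_card_fiberwise hmaps]
  simp only [hfib]
  rw [sum_range_succ', forests_zero, card_empty, add_zero,
    show m + 2 = 1 + (m + 1) by ring, add_pow]
  refine sum_congr rfl fun k hk => ?_
  rw [card_forests hm (by rw [mem_range] at hk; omega)]
  simp

open scoped Classical in
/-- A bisection structure comes from as many forests as there are choices of a root. -/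
lemma card_bisection_fiber [Nontrivial X] {R : X → X → X → Prop} (hR : IsBisection R) :
    #((univ.filter fun lt : X → X → Prop => IsForest lt).filter fun lt => bisection lt = R) =
      Fintype.card X + 1 := by
  obtain ⟨lt, h, rfl⟩ := hR.exists_forest
  rw [← Fintype.card_option, ← card_univ]
  symm
  refine card_bij (fun o _ => reroot lt o) ?_ ?_ ?_
  · intro o _
    simp [isForest_reroot h, bisection_reroot]
  · intro o _ o' _ heq
    exact reroot_injective h heq
  · intro lt' hlt'
    simp only [mem_filter, mem_univ, true_and] at hlt'
    obtain ⟨o, ho⟩ := exists_reroot_eq h hlt'.1 hlt'.2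
    exact ⟨o, mem_univ o, ho⟩

end IsForest

/-- The number of bisection structures on a finite set with
`n ≥ 2` elements is `(n+1)^(n-2)`. -/
theorem card_bisection {X : Type} [Fintype X] (n : ℕ) (hn : n = Fintype.card X)
    (h2 : 2 ≤ n) :
    Nat.card {R : X → X → X → Prop // IsBisection R} = (n + 1) ^ (n - 2) := by
  classical
  obtain ⟨m, rfl⟩ : ∃ m, n = m + 2 := ⟨n - 2, by omega⟩
  have : Nontrivial X := Fintype.one_lt_card_iff_nontrivial.1 (by omega)
  have hmaps : ∀ lt ∈ Finset.univ.filter (fun lt : X → X → Prop => IsForest lt),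
      IsForest.bisection lt ∈
        Finset.univ.filter (fun R : X → X → X → Prop => IsBisection R) := by
    intro lt hlt
    simpa using IsForest.isBisection (by simpa using hlt)
  have hcount := Finset.card_eq_sum_card_fiberwise hmaps
  rw [IsForest.card_filter_isForest (m := m + 1) (by omega),
    Finset.sum_const_nat fun R hR => IsForest.card_bisection_fiber (by simpa using hR),
    ← hn] at hcount
  rw [Nat.card_eq_fintype_card, Fintype.card_subtype, Nat.add_sub_cancel]
  refine Nat.eq_of_mul_eq_mul_right (show 0 < m + 2 + 1 by omega) (hcount.symm.trans ?_)
  ring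
end

section
/- Let X be a finite set with n elements, where n ≥ 1. Then the number of oriented bisection structures on X equals 2^n · (n+1)^{n-2} (for n = 1 this value is 2^1 · 2^{-1} = 1). -/
/-- The condition on triples of an oriented bisection structure, for `Bool`-valued functions. -/
def IsBisection_s6 {X : Type*} (S : X → X → Bool) : Prop :=
  ∀ x y z : X, x ≠ y → y ≠ z → x ≠ z →
    ((S x y = S x z ∧ S y x = S y z) ∨ (S x y = S x z ∧ S z x = S z y) ∨
      (S y x = S y z ∧ S z x = S z y))

/-- Regarding a bisection structure as a tree with edge set `X`, a vertex of this tree is given by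
a choice of a side of every edge, no two of the chosen sides being disjoint. -/
def IsVertex {X : Type*} (S : X → X → Bool) (f : X → Bool) : Prop :=
  ∀ x y, x ≠ y → f x = S x y ∨ f y = S y x

/-- A forest order: a strict order in which the elements below a given one form a chain. -/
structure IsForest_s6 {X : Type*} (r : X → X → Prop) : Prop where
  irrefl : ∀ x, ¬ r x x
  trans : ∀ x y z, r x y → r y z → r x z
  chain : ∀ x y z, r x z → r y z → x = y ∨ r x y ∨ r y x

/-- Forest orders on `X` together with a colouring that is constant on every tree. -/
def ColoredForest (X W : Type*) : Type _ :=
  {p : (X → X → Prop) × (X → W) // IsForest_s6 p.1 ∧ ∀ x y, p.1 x y → p.2 x = p.2 y}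

instance {X W : Type*} [Finite X] [Finite W] : Finite (ColoredForest X W) :=
  inferInstanceAs (Finite (Subtype _))

theorem IsBisection_s6.card_vertices {X : Type*} [Fintype X] :
    ∀ S : X → X → Bool, IsBisection_s6 S → Nat.card {f // IsVertex S f} = Fintype.card X + 1 := by
  refine Fintype.induction_empty_option (P := fun X _ => ∀ S : X → X → Bool, IsBisection_s6 S →
    Nat.card {f // IsVertex S f} = Fintype.card X + 1) ?_ ?_ ?_ X
  · intro α β _ e ih S hS
    let _ := Fintype.ofEquiv β e.symm
    rw [← Fintype.card_congr e, ← ih (fun x y => S (e x) (e y))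
      (fun x y z h1 h2 h3 => hS _ _ _ (e.injective.ne h1) (e.injective.ne h2) (e.injective.ne h3))]
    refine Nat.card_congr ((e.arrowCongr (Equiv.refl Bool)).subtypeEquiv fun f => ?_).symm
    constructor
    · intro h x y hxy
      simpa using h (e.symm x) (e.symm y) (e.symm.injective.ne hxy)
    · intro h x y hxy
      simpa using h (e x) (e y) (e.injective.ne hxy)
  · intro S _
    have : Unique {f // IsVertex S f} :=
      { default := ⟨fun x => x.elim, fun x => x.elim⟩
        uniq := fun f => Subtype.ext (Subsingleton.elim _ _) }
    simp
  · intro α _ ih S hS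
    classical
    have hS' : IsBisection_s6 fun x y : α => S (some x) (some y) := fun x y z h1 h2 h3 =>
      hS _ _ _ (by simpa using h1) (by simpa using h2) (by simpa using h3)
    rw [Fintype.card_option, ← ih _ hS', ← Finite.card_option]
    have hz : ∀ x y : α, x ≠ y →
        (S (some x) (some y) = S (some x) none ∧ S (some y) (some x) = S (some y) none) ∨
        (S (some x) (some y) = S (some x) none ∧ S none (some x) = S none (some y)) ∨
        (S (some y) (some x) = S (some y) none ∧ S none (some x) = S none (some y)) :=
      fun x y h => hS _ _ _ (by simpa using h) (by simp) (by simp)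
    let φ : {f // IsVertex S f} → Option {f // IsVertex (fun x y : α => S (some x) (some y)) f} :=
      fun f => if (∀ x, f.1 (some x) = S (some x) none) ∧ f.1 none = true then none
        else some ⟨fun x => f.1 (some x), fun x y h => f.2 _ _ (by simpa using h)⟩
    refine Nat.card_congr (Equiv.ofBijective φ ⟨?_, ?_⟩)
    · rintro ⟨f, hf⟩ ⟨g, hg⟩ h
      have hf' := fun x => hf (some x) none (by simp)
      have hg' := fun x => hg (some x) none (by simp)
      have key : (∀ x, f (some x) = g (some x)) ∧ f none = g none := by
        by_cases h1 : (∀ x, f (some x) = S (some x) none) ∧ f none = true <;>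
        by_cases h2 : (∀ x, g (some x) = S (some x) none) ∧ g none = true
        · grind
        · simp [φ, h1, h2] at h
        · simp [φ, h1, h2] at h
        · simp only [φ, h1, h2, if_false, Option.some.injEq] at h
          replace h : ∀ x, f (some x) = g (some x) := congrFun (congrArg Subtype.val h)
          refine ⟨h, ?_⟩
          by_cases h3 : ∀ x, f (some x) = S (some x) none
          · have h4 : ∀ x, g (some x) = S (some x) none := fun x => (h x).symm.trans (h3 x)
            have h5 : f none ≠ true := fun h => h1 ⟨h3, h⟩
            have h6 : g none ≠ true := fun h => h2 ⟨h4, h⟩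
            simp_all
          · push Not at h3
            obtain ⟨x, hx⟩ := h3
            have := hf' x
            have := hg' x
            have := h x
            grind
      ext x
      cases x <;> simp [key]
    · have ext_vertex : ∀ (g : α → Bool) (b : Bool),
          IsVertex (fun x y : α => S (some x) (some y)) g →
          (∀ x, g x = S (some x) none ∨ b = S none (some x)) →
          IsVertex S (fun x => x.elim b g) := by
        intro g b hg hb x y hxy
        rcases x with _ | x <;> rcases y with _ | y
        · exact absurd rfl hxy
        · exact (hb y).symm
        · exact hb x
        · exact hg x y (by simpa using hxy)
      rintro (_ | ⟨g, hg⟩)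
      · refine ⟨⟨_, ext_vertex (fun x => S (some x) none) true ?_ fun x => Or.inl rfl⟩, ?_⟩
        · intro x y hxy
          grind
        · simp [φ]
      · by_cases h : ∀ x, g x = S (some x) none
        · exact ⟨⟨_, ext_vertex g false hg fun x => Or.inl (h x)⟩, by simp [φ]⟩
        · have h' := h
          push Not at h
          obtain ⟨x, hx⟩ := h
          refine ⟨⟨_, ext_vertex g (S none (some x)) hg fun y => ?_⟩, ?_⟩
          · by_cases hxy : x = y
            · exact Or.inr (by rw [hxy])
            · have := hg x y hxy
              have := hz x y hxy
              grind
          · simp [φ, h']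

theorem IsForest_s6.exists_root {X : Type*} [Finite X] {r : X → X → Prop} (hr : IsForest_s6 r) (y : X)
    (hy : ∃ x, r x y) : ∃ x, r x y ∧ ∀ z, ¬ r z x := by
  have : IsTrans X r := ⟨hr.trans⟩
  have : Std.Irrefl r := ⟨hr.irrefl⟩
  obtain ⟨x, hx, hmin⟩ := (Finite.wellFounded_of_trans_of_irrefl r).has_min {x | r x y} hy
  exact ⟨x, hx, fun z hz => hmin z (hr.trans _ _ _ hz hx) hz⟩

/-- Removing the roots of a coloured forest leaves a forest coloured by these roots. -/
theorem ColoredForest.card_rootsEq {X W : Type*} [Fintype X] [Fintype W] (R : Finset X) :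
    Nat.card {p : ColoredForest X W // ∀ x, x ∈ R ↔ ∀ y, ¬ p.1.1 y x} =
      Fintype.card W ^ R.card * Nat.card (ColoredForest {x // x ∉ R} R) := by
  classical
  have hfun : Fintype.card W ^ R.card = Nat.card (R → W) := by simp
  rw [hfun, ← Nat.card_prod]
  let rel : ColoredForest {x // x ∉ R} R → X → X → Prop := fun q x y =>
    (∃ hx hy, q.1.1 ⟨x, hx⟩ ⟨y, hy⟩) ∨ ∃ hy, (q.1.2 ⟨y, hy⟩ : X) = x
  let col : (R → W) → ColoredForest {x // x ∉ R} R → X → W := fun d q y =>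
    if h : y ∈ R then d ⟨y, h⟩ else d (q.1.2 ⟨y, h⟩)
  have hforest : ∀ q, IsForest_s6 (rel q) := by
    rintro ⟨⟨s, e⟩, hs, he⟩
    constructor
    · rintro x (⟨hx, hx', h⟩ | ⟨hx, h⟩)
      · exact hs.irrefl _ h
      · exact hx (h ▸ (e ⟨x, hx⟩).2)
    · rintro x y z (⟨hx, hy, h⟩ | ⟨hy, h⟩) (⟨hy', hz, h'⟩ | ⟨hz, h'⟩)
      · exact Or.inl ⟨hx, hz, hs.trans _ _ _ h h'⟩
      · exact absurd (h' ▸ (e ⟨z, hz⟩).2) hy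
      · exact Or.inr ⟨hz, by rw [← h]; exact congrArg _ (he _ _ h').symm⟩
      · exact absurd (h' ▸ (e ⟨z, hz⟩).2) hy
    · rintro x y z (⟨hx, hz, h⟩ | ⟨hz, h⟩) (⟨hy, hz', h'⟩ | ⟨hz', h'⟩)
      · rcases hs.chain _ _ _ h h' with h1 | h1 | h1
        · exact Or.inl (congrArg Subtype.val h1)
        · exact Or.inr (Or.inl (Or.inl ⟨hx, hy, h1⟩))
        · exact Or.inr (Or.inr (Or.inl ⟨hy, hx, h1⟩))
      · exact Or.inr (Or.inr (Or.inr ⟨hx, by rw [← h']; exact congrArg _ (he _ _ h)⟩))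
      · exact Or.inr (Or.inl (Or.inr ⟨hy, by rw [← h]; exact congrArg _ (he _ _ h')⟩))
      · exact Or.inl (h.symm.trans h')
  have hcol : ∀ d q x y, rel q x y → col d q x = col d q y := by
    rintro d ⟨⟨s, e⟩, hs, he⟩ x y (⟨hx, hy, h⟩ | ⟨hy, rfl⟩)
    · simp only [col, hx, hy, dif_neg, not_false_iff]
      exact congrArg d (he _ _ h)
    · simp [col, hy]
  have hroots : ∀ q x, x ∈ R ↔ ∀ y, ¬ rel q y x := by
    rintro ⟨⟨s, e⟩, hs, he⟩ x
    constructor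
    · rintro hx y (⟨-, hx', -⟩ | ⟨hx', -⟩) <;> exact hx' hx
    · intro h
      by_contra hx
      exact h (e ⟨x, hx⟩) (Or.inr ⟨hx, rfl⟩)
  symm
  let φ : (R → W) × ColoredForest {x // x ∉ R} R →
      {p : ColoredForest X W // ∀ x, x ∈ R ↔ ∀ y, ¬ p.1.1 y x} := fun p =>
    ⟨⟨(rel p.2, col p.1 p.2), hforest p.2, hcol p.1 p.2⟩, hroots p.2⟩
  refine Nat.card_congr (Equiv.ofBijective φ ⟨?_, ?_⟩)
  · rintro ⟨d, q⟩ ⟨d', q'⟩ h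
    have h1 : rel q = rel q' := congrArg (fun p => p.1.1.1) h
    have h2 : col d q = col d' q' := congrArg (fun p => p.1.1.2) h
    have hd : d = d' := by
      ext ⟨x, hx⟩
      have := congrFun h2 x
      simpa [col, hx] using this
    have hrel : ∀ x y, rel q x y ↔ rel q' x y := fun x y => by rw [h1]
    obtain ⟨⟨s, e⟩, hs, he⟩ := q
    obtain ⟨⟨s', e'⟩, hs', he'⟩ := q'
    have hse : s = s' := by
      ext ⟨x, hx⟩ ⟨y, hy⟩
      have h3 := hrel x y
      have h4 : (e ⟨y, hy⟩ : X) ≠ x := fun h => hx (h ▸ (e ⟨y, hy⟩).2)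
      have h5 : (e' ⟨y, hy⟩ : X) ≠ x := fun h => hx (h ▸ (e' ⟨y, hy⟩).2)
      simpa [rel, hx, hy, h4, h5] using h3
    have hee : e = e' := by
      ext ⟨y, hy⟩
      have h3 := hrel (e ⟨y, hy⟩) y
      have h4 := (e ⟨y, hy⟩).2
      simpa [rel, hy, h4, eq_comm] using h3
    subst hd hse hee
    rfl
  · rintro ⟨⟨⟨r, c⟩, hr, hc⟩, hR⟩
    dsimp only at hr hc hR
    have hex : ∀ y : {x // x ∉ R}, ∃ x : R, r x y := by
      rintro ⟨y, hy⟩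
      rw [hR] at hy
      push Not at hy
      obtain ⟨x, hx, hx'⟩ := hr.exists_root y hy
      exact ⟨⟨x, (hR x).2 hx'⟩, hx⟩
    choose e he using hex
    have huniq : ∀ (x y : X) (hy : y ∉ R), x ∈ R → r x y → (e ⟨y, hy⟩ : X) = x := by
      intro x y hy hx h
      rcases hr.chain _ _ _ (he ⟨y, hy⟩) h with h1 | h1 | h1
      · exact h1
      · exact absurd h1 ((hR x).1 hx _)
      · exact absurd h1 ((hR _).1 (e ⟨y, hy⟩).2 _)
    refine ⟨⟨fun x => c x, ⟨⟨fun x y => r x y, e⟩, ⟨fun x => hr.irrefl x,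
      fun x y z => hr.trans x y z, ?_⟩, ?_⟩⟩, ?_⟩
    · intro x y z h h'
      simpa [Subtype.ext_iff] using hr.chain _ _ _ h h'
    · intro x y h
      exact (Subtype.ext (huniq _ _ _ (e x).2 (hr.trans _ _ _ (he x) h))).symm
    · apply Subtype.ext
      apply Subtype.ext
      apply Prod.ext
      · ext x y
        constructor
        · rintro (⟨hx, hy, h⟩ | ⟨hy, rfl⟩)
          · exact h
          · exact he _
        · intro h
          have hy : y ∉ R := fun hy => (hR y).1 hy _ h
          by_cases hx : x ∈ R
          · exact Or.inr ⟨hy, huniq x y hy hx h⟩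
          · exact Or.inl ⟨hx, hy, h⟩
      · ext y
        by_cases hy : y ∈ R
        · simp [φ, col, hy]
        · simpa [φ, col, hy] using hc _ _ (he ⟨y, hy⟩)

theorem ColoredForest.card_eq_sum (X W : Type*) [Fintype X] [Fintype W] :
    Nat.card (ColoredForest X W) =
      ∑ R : Finset X, Fintype.card W ^ R.card * Nat.card (ColoredForest {x // x ∉ R} R) := by
  classical
  let roots : ColoredForest X W → Finset X := fun p =>
    Finset.univ.filter fun x => ∀ y, ¬ p.1.1 y x
  rw [← Nat.card_congr (Equiv.sigmaFiberEquiv roots), Nat.card_sigma]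
  refine Finset.sum_congr rfl fun R _ => ?_
  rw [← ColoredForest.card_rootsEq]
  refine Nat.card_congr (Equiv.subtypeEquivRight fun p => ?_)
  simp [roots, Finset.ext_iff, iff_comm]

theorem sum_choose_mul_mul_pow (m w : ℕ) :
    ∑ k ∈ Finset.range (m + 2), (m + 1).choose k * (w ^ k * (k * (m + 1) ^ (m + 1 - k))) =
      (m + 1) * (w * (w + (m + 1)) ^ m) := by
  rw [Finset.sum_range_succ', add_pow w, Finset.mul_sum, Finset.mul_sum, zero_mul, mul_zero,
    mul_zero, add_zero]
  refine Finset.sum_congr rfl fun k _ => ?_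
  have h := Nat.add_one_mul_choose_eq m k
  rw [Nat.add_sub_add_right]
  calc _ = ((m + 1).choose (k + 1) * (k + 1)) * (w ^ (k + 1) * (m + 1) ^ (m - k)) := by ring
    _ = _ := by rw [← h, Nat.cast_id]; ring

theorem ColoredForest.card_of_isEmpty (X W : Type*) [IsEmpty X] :
    Nat.card (ColoredForest X W) = 1 := by
  have : Unique (ColoredForest X W) :=
    { default := ⟨(isEmptyElim, isEmptyElim), ⟨isEmptyElim, isEmptyElim, isEmptyElim⟩,
        isEmptyElim⟩
      uniq := fun f => Subtype.ext (Subsingleton.elim _ _) }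
  simp

theorem ColoredForest.card_succ (m : ℕ) : ∀ (X W : Type) [Fintype X] [Fintype W],
    Fintype.card X = m + 1 →
    Nat.card (ColoredForest X W) = Fintype.card W * (Fintype.card W + (m + 1)) ^ m := by
  induction m using Nat.strong_induction_on with
  | _ m ih =>
  intro X W _ _ hX
  classical
  have key : ∀ R : Finset X, (m + 1) * Nat.card (ColoredForest {x // x ∉ R} R) =
      R.card * (m + 1) ^ (m + 1 - R.card) := by
    intro R
    have hc : Fintype.card {x // x ∉ R} = m + 1 - R.card := by
      rw [Fintype.card_subtype_compl, hX, Fintype.card_coe]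
    have hle : R.card ≤ m + 1 := hX ▸ R.card_le_univ
    rcases Nat.eq_zero_or_pos R.card with h0 | h0
    · have : Nonempty {x // x ∉ R} := Fintype.card_pos_iff.1 (by omega)
      have hR : IsEmpty R := Fintype.card_eq_zero_iff.1 (by rw [Fintype.card_coe, h0])
      have : IsEmpty (ColoredForest {x // x ∉ R} R) := ⟨fun p => hR.false (p.1.2 this.some)⟩
      simp [h0]
    · rcases hle.eq_or_lt with h1 | h1
      · have : IsEmpty {x // x ∉ R} := Fintype.card_eq_zero_iff.1 (by omega)
        rw [ColoredForest.card_of_isEmpty]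
        simp [h1]
      · obtain ⟨j, hj⟩ : ∃ j, m + 1 - R.card = j + 1 := ⟨m - R.card, by omega⟩
        rw [ih j (by omega) _ _ (hc.trans hj), hj, Fintype.card_coe,
          show R.card + (j + 1) = m + 1 by omega]
        ring
  have hpos : 0 < m + 1 := m.succ_pos
  refine Nat.eq_of_mul_eq_mul_left hpos ?_
  rw [← sum_choose_mul_mul_pow, ColoredForest.card_eq_sum, Finset.mul_sum]
  have h := Finset.sum_powerset_apply_card
    (fun k => Fintype.card W ^ k * (k * (m + 1) ^ (m + 1 - k))) (x := (Finset.univ : Finset X))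
  rw [Finset.powerset_univ, Finset.card_univ, hX] at h
  simp only [smul_eq_mul] at h
  rw [← h]
  refine Finset.sum_congr rfl fun R _ => ?_
  rw [← key]
  ring

/-- A bisection structure with a chosen vertex is a rooted forest together with an independent
choice of an orientation at every element. -/
theorem card_bisection_vertex (X : Type) [Fintype X] :
    Nat.card {p : (X → X → Bool) × (X → Bool) //
      ((∀ a, p.1 a a = false) ∧ IsBisection_s6 p.1) ∧ IsVertex p.1 p.2} =
      2 ^ Fintype.card X * Nat.card (ColoredForest X Unit) := by
  classical
  have hfun : 2 ^ Fintype.card X = Nat.card (X → Bool) := by simp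
  rw [hfun, ← Nat.card_prod]
  symm
  let T : (X → Bool) → ColoredForest X Unit → X → X → Bool := fun f q x y =>
    if x = y then false else xor (decide (q.1.1 x y)) (f x)
  have hT : ∀ f q, ((∀ a, T f q a a = false) ∧ IsBisection_s6 (T f q)) ∧ IsVertex (T f q) f := by
    rintro f ⟨⟨r, c⟩, ⟨hi, ht, hc⟩, -⟩
    dsimp only at hi ht hc
    refine ⟨⟨fun a => by simp [T], fun x y z hxy hyz hxz => ?_⟩, fun x y hxy => ?_⟩
    · have key : (r x y ↔ r x z) ∧ (r y x ↔ r y z) ∨ (r x y ↔ r x z) ∧ (r z x ↔ r z y) ∨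
          (r y x ↔ r y z) ∧ (r z x ↔ r z y) := by
        have h1 := ht x y z
        have h2 := ht x z y
        have h3 := ht y x z
        have h4 := ht y z x
        have h5 := ht z x y
        have h6 := ht z y x
        have h7 := hc x y z
        have h8 := hc x z y
        have h9 := hc y z x
        have h10 := ht x y x
        have h11 := ht x z x
        have h12 := ht y z y
        have h13 := hi x
        have h14 := hi y
        clear ht hc hi
        grind
      simpa [T, hxy, hyz, hxz, hxy.symm, hyz.symm, hxz.symm] using key
    · have h1 : ¬ (r x y ∧ r y x) := fun h => hi x (ht x y x h.1 h.2)
      by_cases h : r x y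
      · have h2 : ¬ r y x := fun h' => h1 ⟨h, h'⟩
        simp [T, hxy.symm, h2]
      · simp [T, hxy, h]
  let φ : (X → Bool) × ColoredForest X Unit → {p : (X → X → Bool) × (X → Bool) //
      ((∀ a, p.1 a a = false) ∧ IsBisection_s6 p.1) ∧ IsVertex p.1 p.2} :=
    fun p => ⟨(T p.1 p.2, p.1), hT p.1 p.2⟩
  refine Nat.card_congr (Equiv.ofBijective φ ⟨?_, ?_⟩)
  · rintro ⟨f, q⟩ ⟨f', q'⟩ h
    have h1 : T f q = T f' q' := congrArg (fun p => p.1.1) h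
    obtain rfl : f = f' := congrArg (fun p => p.1.2) h
    obtain ⟨⟨r, c⟩, hr, hc⟩ := q
    obtain ⟨⟨r', c'⟩, hr', hc'⟩ := q'
    obtain rfl : r = r' := by
      ext x y
      by_cases hxy : x = y
      · subst hxy
        exact iff_of_false (hr.irrefl x) (hr'.irrefl x)
      · simpa [T, hxy] using congrFun (congrFun h1 x) y
    obtain rfl : c = c' := Subsingleton.elim _ _
    rfl
  · rintro ⟨⟨S, f⟩, ⟨h0, hS⟩, hf⟩
    dsimp only at h0 hS hf
    refine ⟨(f, ⟨(fun x y => x ≠ y ∧ S x y ≠ f x, fun _ => ()), ⟨?_, ?_, ?_⟩, fun _ _ _ => rfl⟩),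
      ?_⟩
    · exact fun x h => h.1 rfl
    · intro x y z h h'
      have := hS x y z
      have := hf x y
      have := hf y z
      grind
    · intro x y z h h'
      have := hS x y z
      have := hf x y
      grind
    · apply Subtype.ext
      refine Prod.ext ?_ rfl
      ext x y
      by_cases hxy : x = y
      · simp [φ, T, hxy, h0]
      · cases h : S x y <;> cases h' : f x <;> simp [φ, T, hxy, h, h']

theorem card_bisection_mul (X : Type) [Fintype X] :
    Nat.card {S : X → X → Bool // (∀ a, S a a = false) ∧ IsBisection_s6 S} * (Fintype.card X + 1) =
      2 ^ Fintype.card X * Nat.card (ColoredForest X Unit) := by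
  classical
  rw [← card_bisection_vertex]
  let e : {p : (X → X → Bool) × (X → Bool) //
      ((∀ a, p.1 a a = false) ∧ IsBisection_s6 p.1) ∧ IsVertex p.1 p.2} ≃
      (S : {S : X → X → Bool // (∀ a, S a a = false) ∧ IsBisection_s6 S}) ×
        {f // IsVertex S.1 f} :=
    { toFun := fun p => ⟨⟨p.1.1, p.2.1⟩, ⟨p.1.2, p.2.2⟩⟩
      invFun := fun q => ⟨(q.1.1, q.2.1), q.1.2, q.2.2⟩ }
  have := Fintype.ofFinite {S : X → X → Bool // (∀ a, S a a = false) ∧ IsBisection_s6 S}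
  rw [Nat.card_congr e, Nat.card_sigma,
    Finset.sum_congr rfl fun S _ => IsBisection_s6.card_vertices S.1 S.2.2]
  simp

theorem card_isOrientedBisection_eq (X : Type) :
    Nat.card {S : X → X → ℕ // IsOrientedBisection S} =
      Nat.card {S : X → X → Bool // (∀ a, S a a = false) ∧ IsBisection_s6 S} := by
  symm
  refine Nat.card_congr (Equiv.ofBijective (fun S => ⟨fun x y => (S.1 x y).toNat,
    fun a b => ?_, fun a => by simp [S.2.1 a], fun x y z h1 h2 h3 => ?_⟩) ⟨?_, ?_⟩)
  · cases S.1 a b <;> simp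
  · rcases S.2.2 x y z h1 h2 h3 with h | h | h <;> simp [h]
  · rintro ⟨S, hS⟩ ⟨S', hS'⟩ h
    have h1 : (fun x y => (S x y).toNat) = fun x y => (S' x y).toNat := congrArg Subtype.val h
    refine Subtype.ext (funext₂ fun x y => ?_)
    have h2 := congrFun (congrFun h1 x) y
    cases h3 : S x y <;> cases h4 : S' x y <;> simp_all
  · rintro ⟨S, h01, h0, hS⟩
    refine ⟨⟨fun x y => decide (S x y = 1), fun a => by simp [h0], fun x y z h1 h2 h3 => ?_⟩, ?_⟩
    · rcases hS x y z h1 h2 h3 with h | h | h <;> simp [h]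
    · refine Subtype.ext (funext₂ fun x y => ?_)
      rcases h01 x y with h | h <;> simp [h]

/-- The number of oriented bisection structures on a finite set
with `n ≥ 1` elements is `2^n · (n+1)^(n-2)`, where the exponent `n - 2` is an
integer (so for `n = 1` the value is `2 · 2⁻¹ = 1`). -/
theorem card_orientedBisection {X : Type} [Fintype X] (n : ℕ)
    (hn : n = Fintype.card X) (h1 : 1 ≤ n) :
    (Nat.card {S : X → X → ℕ // IsOrientedBisection S} : ℚ) =
      2 ^ n * ((n : ℚ) + 1) ^ ((n : ℤ) - 2) := by
  obtain ⟨m, rfl⟩ : ∃ m, n = m + 1 := ⟨n - 1, by omega⟩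
  have h := card_bisection_mul X
  rw [← card_isOrientedBisection_eq, ColoredForest.card_succ m X Unit hn.symm, ← hn] at h
  have hq := congrArg (Nat.cast : ℕ → ℚ) h
  push_cast [Fintype.card_unit] at hq
  have hne : (m : ℚ) + 1 + 1 ≠ 0 := by positivity
  push_cast
  rw [show (m : ℤ) + 1 - 2 = m - 1 by ring, zpow_sub₀ hne, zpow_natCast, zpow_one,
    ← mul_div_assoc, eq_div_iff hne, hq]
  ring
end

section
/- Let Σ be a nonempty finite set, k a commutative ring, and ν a Σ-measure valued in k. Define η : Σ³ → k by η_{a,b}(c) = ν_{a,b}(c), where c is regarded as a word of length one. Then η is a Σ-symbol. -/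
/-- A `Σ`-measure valued in a commutative ring `k` (alphabet `A`): a rule `ν`
assigning to `a b : A` and a word `w : List A` an element `ν a b w : k`, such
that (a) `ν a b [] = 1`; (b) `ν a b (w ++ c :: w') = ν a b (w ++ w') * ν wr w'1 c`
where `wr` is the last letter of `w` (or `a` if `w` is empty) and `w'1` is the
first letter of `w'` (or `b` if `w'` is empty); (c) the splitting relation with
respect to any letter `c` (here `w.take i = w[1,i]`, `w.drop i = w(i,n]`, and the
second sum runs over the positions of `w` carrying the letter `c`). -/
structure IsSigmaMeasure {A : Type} [DecidableEq A] {k : Type} [CommRing k]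
    (ν : A → A → List A → k) : Prop where
  nil : ∀ a b : A, ν a b [] = 1
  ins : ∀ (a b c : A) (w w' : List A),
    ν a b (w ++ c :: w') = ν a b (w ++ w') * ν (w.getLastD a) (w'.headD b) [c]
  split : ∀ (a b c : A) (w : List A),
    ν a b w = (∑ i ∈ Finset.range (w.length + 1), ν a c (w.take i) * ν c b (w.drop i))
      + ∑ j ∈ Finset.range w.length,
          if w.getD j c = c then ν a c (w.take j) * ν c b (w.drop (j + 1)) else 0

/-- A `Σ`-symbol valued in a commutative ring `k` (alphabet `A`): a function
`η : A³ → k`, written `η a b c` for `η_{a,b}(c)`, satisfying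
`η a b c * η c b d = η a b d * η a d c` and
`η a b c = η a d c + η d b c + δ_{c,d}`. -/
structure IsSigmaSymbol {A : Type} [DecidableEq A] {k : Type} [CommRing k]
    (η : A → A → A → k) : Prop where
  rel1 : ∀ a b c d : A, η a b c * η c b d = η a b d * η a d c
  rel2 : ∀ a b c d : A, η a b c = η a d c + η d b c + (if c = d then 1 else 0)

/-- The restriction of a `Σ`-measure to words of length one is a
`Σ`-symbol. -/
theorem sigmaMeasure_restrict_isSymbol {A k : Type} [Fintype A] [Nonempty A]
    [DecidableEq A] [CommRing k] (ν : A → A → List A → k)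
    (hν : IsSigmaMeasure ν) :
    IsSigmaSymbol (fun a b c => ν a b [c]) := by
  refine ⟨fun a b c d => ?_, fun a b c d => ?_⟩
  · have hd := hν.ins a b d [c] []
    have hc := hν.ins a b c [] [d]
    simp only [List.nil_append, List.append_nil, List.singleton_append, List.getLastD_cons,
      List.getLastD_nil, List.headD_cons, List.headD_nil] at hd hc
    exact hd.symm.trans hc
  · have h := hν.split a b d [c]
    simp [Finset.sum_range_succ, hν.nil] at h
    rw [h, add_comm (ν d b [c])]
end

section
/- Let Σ be a nonempty finite set and k a commutative ring. If ν and ν' are Σ-measures valued in k such that ν_{a,b}(c) = ν'_{a,b}(c) for all a, b, c ∈ Σ (words of length one), then ν = ν', i.e., ν_{a,b}(w) = ν'_{a,b}(w) for all a, b ∈ Σ and all words w ∈ Σ*. -/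
/-- Two `Σ`-measures that agree on all words of length one are
equal. -/
theorem sigmaMeasure_ext {A k : Type} [Fintype A] [Nonempty A] [DecidableEq A]
    [CommRing k] (ν ν' : A → A → List A → k)
    (hν : IsSigmaMeasure ν) (hν' : IsSigmaMeasure ν')
    (h1 : ∀ a b c : A, ν a b [c] = ν' a b [c]) :
    ∀ (a b : A) (w : List A), ν a b w = ν' a b w := by
  intro a b w
  induction w with
  | nil => rw [hν.nil, hν'.nil]
  | cons c w ih =>
    have h := hν.ins a b c [] w
    have h' := hν'.ins a b c [] w
    simp only [List.nil_append] at h h'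
    rw [h, h', ih, h1]
end

section
/- Let Σ be a nonempty finite set, k a commutative ring, and η a Σ-symbol valued in k. Define ν recursively by ν_{a,b}(∅) = 1 and ν_{a,b}(w_1⋯w_n) = η_{a,b}(w_n) · ν_{a,w_n}(w_1⋯w_{n-1}) for n ≥ 1. Then ν is a Σ-measure valued in k, and ν_{a,b}(c) = η_{a,b}(c) for all a, b, c ∈ Σ. -/
section RecursiveDefinition

variable {A k : Type} [DecidableEq A] [CommRing k] {η : A → A → A → k}
  {ν : A → A → List A → k}

theorem IsSigmaSymbol.insert_letter (hη : IsSigmaSymbol η) (hnil : ∀ a b : A, ν a b [] = 1)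
    (hrec : ∀ (a b c : A) (w : List A), ν a b (w ++ [c]) = η a b c * ν a c w)
    (a b c : A) (w w' : List A) :
    ν a b (w ++ c :: w') = ν a b (w ++ w') * η (w.getLastD a) (w'.headD b) c := by
  induction w' using List.reverseRecOn generalizing b with
  | nil =>
    rcases w.eq_nil_or_concat' with rfl | ⟨u, d, rfl⟩
    · simpa [hnil] using hrec a b c []
    · have hlast : (u ++ [d]).getLastD a = d := by simp
      rw [hrec, hrec, List.append_nil, hrec, hlast, List.headD_nil]
      linear_combination -ν a d u * hη.rel1 a b d c
  | append_singleton u d ih =>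
    have hhead : (u ++ [d]).headD b = u.headD d := by cases u <;> rfl
    rw [← List.cons_append, ← List.append_assoc, ← List.append_assoc, hrec, hrec, ih, hhead,
      mul_assoc]

theorem IsSigmaSymbol.split_at_letter (hη : IsSigmaSymbol η) (hnil : ∀ a b : A, ν a b [] = 1)
    (hrec : ∀ (a b c : A) (w : List A), ν a b (w ++ [c]) = η a b c * ν a c w)
    (a b c : A) (w : List A) :
    ν a b w = (∑ i ∈ Finset.range (w.length + 1), ν a c (w.take i) * ν c b (w.drop i))
      + ∑ j ∈ Finset.range w.length,
          if w.getD j c = c then ν a c (w.take j) * ν c b (w.drop (j + 1)) else 0 := by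
  induction w using List.reverseRecOn generalizing b with
  | nil => simp [hnil]
  | append_singleton u d ih =>
    have hcuts : ∑ i ∈ Finset.range (u.length + 1),
          ν a c ((u ++ [d]).take i) * ν c b ((u ++ [d]).drop i)
        = η c b d * ∑ i ∈ Finset.range (u.length + 1),
          ν a c (u.take i) * ν c d (u.drop i) := by
      rw [Finset.mul_sum]
      refine Finset.sum_congr rfl fun i hi => ?_
      have hi' : i ≤ u.length := Nat.lt_succ_iff.mp (Finset.mem_range.mp hi)
      rw [List.take_append_of_le_length hi', List.drop_append_of_le_length hi', hrec]
      ring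
    have hletter : ∑ j ∈ Finset.range u.length,
          (if (u ++ [d]).getD j c = c then
            ν a c ((u ++ [d]).take j) * ν c b ((u ++ [d]).drop (j + 1)) else 0)
        = η c b d * ∑ j ∈ Finset.range u.length,
          if u.getD j c = c then ν a c (u.take j) * ν c d (u.drop (j + 1)) else 0 := by
      rw [Finset.mul_sum]
      refine Finset.sum_congr rfl fun j hj => ?_
      have hj' : j < u.length := Finset.mem_range.mp hj
      rw [List.take_append_of_le_length hj'.le, List.drop_append_of_le_length hj', hrec,
        List.getD_append _ _ _ _ hj', mul_ite, mul_zero, mul_left_comm]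
    have hlen : (u ++ [d]).length = u.length + 1 := by simp
    have htake : (u ++ [d]).take (u.length + 1) = u ++ [d] := List.take_of_length_le hlen.le
    have hdrop : (u ++ [d]).drop (u.length + 1) = [] := List.drop_of_length_le hlen.le
    have hget : (u ++ [d]).getD u.length c = d := by simp
    rw [hlen, Finset.sum_range_succ _ (u.length + 1), hcuts,
      Finset.sum_range_succ (fun j => if (u ++ [d]).getD j c = c then _ else _), hletter,
      htake, hdrop, hget, List.take_left, hnil, hrec, hrec, hη.rel2 a b d c]
    split_ifs with hdc
    · subst hdc
      linear_combination η d b d * ih d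
    · linear_combination η c b d * ih d

end RecursiveDefinition

/-- If `η` is a `Σ`-symbol and `ν` is defined recursively by
`ν a b [] = 1` and `ν a b (w₁⋯wₙ) = η a b wₙ * ν a wₙ (w₁⋯wₙ₋₁)`, then `ν` is a
`Σ`-measure and its restriction to words of length one is `η`. -/
theorem sigmaSymbol_gives_measure {A k : Type} [Fintype A] [Nonempty A]
    [DecidableEq A] [CommRing k] (η : A → A → A → k) (hη : IsSigmaSymbol η)
    (ν : A → A → List A → k)
    (hnil : ∀ a b : A, ν a b [] = 1)
    (hrec : ∀ (a b c : A) (w : List A), ν a b (w ++ [c]) = η a b c * ν a c w) :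
    IsSigmaMeasure ν ∧ ∀ a b c : A, ν a b [c] = η a b c := by
  have hsingle : ∀ a b c : A, ν a b [c] = η a b c := fun a b c => by
    simpa [hnil] using hrec a b c []
  refine ⟨⟨hnil, fun a b c w w' => ?_, hη.split_at_letter hnil hrec⟩, hsingle⟩
  rw [hsingle, hη.insert_letter hnil hrec]
end

section
/- Let Σ be a nonempty finite set, k a commutative ring, and η a Σ-symbol valued in k. Then for all a, b, c ∈ Σ: (a) η_{a,a}(c) = −δ_{a,c}; (b) η_{a,b}(c) = η_{c,b}(c) − η_{c,a}(c) − δ_{c,a}; (c) if a ≠ b then η_{a,b}(a)² = −η_{a,b}(a); (d) if a ≠ b then η_{c,b}(a) · η_{c,a}(b) = 0. -/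
/-- Basic identities for a `Σ`-symbol `η`:
(a) `η a a c = −δ_{a,c}`; (b) `η a b c = η c b c − η c a c − δ_{c,a}`;
(c) if `a ≠ b` then `η a b a ^ 2 = −η a b a`;
(d) if `a ≠ b` then `η c b a * η c a b = 0`. -/
theorem sigmaSymbol_identities {A k : Type} [Fintype A] [Nonempty A]
    [DecidableEq A] [CommRing k] (η : A → A → A → k) (hη : IsSigmaSymbol η) :
    (∀ a c : A, η a a c = -(if a = c then 1 else 0)) ∧
    (∀ a b c : A, η a b c = η c b c - η c a c - (if c = a then 1 else 0)) ∧
    (∀ a b : A, a ≠ b → η a b a ^ 2 = -η a b a) ∧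
    (∀ a b c : A, a ≠ b → η c b a * η c a b = 0) := by
  have diag : ∀ a c : A, η a a c = -(if a = c then 1 else 0) := fun a c => by
    have h := hη.rel2 a a c a
    simp only [eq_comm (a := c)] at h
    linear_combination -h
  refine ⟨diag, fun a b c => ?_, fun a b _ => ?_, fun a b c hab => ?_⟩
  · linear_combination -hη.rel2 c b c a
  · have h := hη.rel1 a b a a
    rw [diag a a, if_pos rfl] at h
    linear_combination h
  · have h := hη.rel1 c b b a
    rw [diag b a, if_neg hab.symm] at h
    linear_combination -h
end

section
/- Let Σ be a nonempty finite set, k a commutative ring, ν a Σ-measure valued in k, and η its restriction to length-one words (η_{a,b}(c) = ν_{a,b}(c)). Let a, b ∈ Σ and let w = w_1⋯w_n ∈ Σ* be a word of length n; set w_0 = a and w_{n+1} = b. Then for all indices 0 ≤ i < j < l ≤ n+1, the element η_{w_i, w_l}(w_j) divides ν_{a,b}(w) in k. -/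
/-- Deleting letters from a word yields a divisor of its measure. -/
theorem IsSigmaMeasure.dvd_of_sublist {A k : Type} [DecidableEq A] [CommRing k]
    {ν : A → A → List A → k} (hν : IsSigmaMeasure ν) (a b : A) {s t : List A}
    (h : s.Sublist t) : ν a b s ∣ ν a b t := by
  suffices H : ∀ u, ν a b (u ++ s) ∣ ν a b (u ++ t) from H []
  induction h with
  | slnil => exact fun u => dvd_rfl
  | cons c _ ih =>
    intro u
    rw [hν.ins a b c u]
    exact (ih u).mul_right _
  | cons_cons c _ ih =>
    intro u
    simpa using ih (u ++ [c])

/-- Let `ν` be a `Σ`-measure and `η` its restriction to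
length-one words.  For `a, b` and a word `w` of length `n`, set `w₀ = a` and
`w_{n+1} = b` (so the extended word is `a :: (w ++ [b])`).  Then for all
`0 ≤ i < j < l ≤ n + 1`, the element `η (w_i) (w_l) (w_j)` divides `ν a b w`. -/
theorem sigmaMeasure_divisibility {A k : Type} [Fintype A] [Nonempty A]
    [DecidableEq A] [CommRing k] (ν : A → A → List A → k)
    (hν : IsSigmaMeasure ν) (a b : A) (w : List A) :
    ∀ i j l : ℕ, i < j → j < l → l ≤ w.length + 1 →
      ν ((a :: (w ++ [b])).getD i a) ((a :: (w ++ [b])).getD l a)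
          [(a :: (w ++ [b])).getD j a] ∣ ν a b w := by
  intro i j l hij hjl hl
  obtain ⟨j, rfl⟩ : ∃ m, j = m + 1 := ⟨j - 1, by omega⟩
  obtain ⟨l, rfl⟩ : ∃ m, l = m + 1 := ⟨l - 1, by omega⟩
  have hj : j < w.length := by omega
  have hfirst : (a :: (w ++ [b])).getD i a = (w.take i).getLastD a := by
    rcases i with _ | i
    · simp
    · have hi : i < w.length := by omega
      simp [List.getLastD_eq_getLast?, List.getLast?_take, List.getD_eq_getElem?_getD,
        List.getElem?_append_left hi, List.getElem?_eq_getElem hi]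
  have hlast : (a :: (w ++ [b])).getD (l + 1) a = (w.drop l).headD b := by
    rcases Nat.lt_or_ge l w.length with h | h
    · simp [List.headD_eq_head?_getD, List.getD_eq_getElem?_getD, List.getElem?_append_left h,
        List.getElem?_eq_getElem h]
    · obtain rfl : l = w.length := by omega
      simp [List.getD_eq_getElem?_getD]
  have hmid : (a :: (w ++ [b])).getD (j + 1) a = w[j] := by
    simp [List.getD_eq_getElem?_getD, List.getElem?_append_left hj,
      List.getElem?_eq_getElem hj]
  have hsub : (w.take i ++ w[j] :: w.drop l).Sublist w := by
    have hw : w.take j ++ w[j] :: w.drop (j + 1) = w := by simp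
    conv_rhs => rw [← hw]
    exact (List.take_sublist_take_left (by omega)).append
      ((List.drop_sublist_drop_left w (by omega)).cons_cons _)
  rw [hfirst, hlast, hmid]
  refine dvd_trans ?_ (hν.dvd_of_sublist a b hsub)
  rw [hν.ins]
  exact dvd_mul_left _ _
end

section
/- Let S be a countable set with a circular order whose strict betweenness relation sbtw is everywhere dense (for all a ≠ b in S there exists c with sbtw(a, c, b)), let Σ be a nonempty finite set, and let σ : S → Σ be a coloring such that each color class is dense (for all a ≠ b in S and every t ∈ Σ there exists c with sbtw(a, c, b) and σ(c) = t). Then S is homogeneous: if X and Y are finite subsets of S and i : X → Y is a bijection preserving the betweenness relation btw and the coloring (σ(i(x)) = σ(x) for all x ∈ X), then there exists a bijection g : S → S preserving btw and satisfying σ ∘ g = σ, such that g(x) = i(x) for all x ∈ X. -/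
/-- A finite nonempty set on which a transitive relation is total has a greatest element. -/
theorem Finset.exists_greatest_of_rel {α : Type*} {r : α → α → Prop}
    (htrans : ∀ x y z, r x y → r y z → r x z) {s : Finset α} (hs : s.Nonempty)
    (htot : ∀ x ∈ s, ∀ y ∈ s, x = y ∨ r x y ∨ r y x) : ∃ m ∈ s, ∀ x ∈ s, x = m ∨ r x m := by
  induction hs using Finset.Nonempty.cons_induction with
  | singleton a => exact ⟨a, by simp⟩
  | cons a s ha hs ih =>
    obtain ⟨m, hm, hmax⟩ := ih fun x hx y hy =>
      htot x (Finset.mem_cons_of_mem hx) y (Finset.mem_cons_of_mem hy)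
    have := htot a (Finset.mem_cons_self a s) m (Finset.mem_cons_of_mem hm)
    simp only [Finset.mem_cons]
    grind

namespace CircularOrder

variable {S C : Type*} [CircularOrder S]

theorem sbtw_or_sbtw_of_ne {a b c : S} (hab : a ≠ b) (hbc : b ≠ c) (hca : c ≠ a) :
    sbtw a b c ∨ sbtw a c b := by
  by_contra! h
  have h₁ : btw c b a := btw_iff_not_sbtw.2 h.1
  have h₂ : btw b c a := btw_iff_not_sbtw.2 h.2
  rcases h₁.antisymm h₂.cyclic_right with h | h | h
  exacts [hbc h.symm, hab h.symm, hca h.symm]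

theorem sbtw_of_sbtw_of_sbtw {o u v w : S} (h₁ : sbtw o u v) (h₂ : sbtw o v w) :
    sbtw u v w :=
  (h₂.cyclic_right.trans_left h₁).cyclic_left

/-- After cutting the circle at `o`, strict betweenness is determined by the linear order
`fun x y => sbtw o x y`. -/
theorem sbtw_iff_of_ne {o x y z : S} (hx : x ≠ o) (hy : y ≠ o) (hz : z ≠ o) :
    sbtw x y z ↔ (sbtw o x y ∧ sbtw o y z) ∨ (sbtw o y z ∧ sbtw o z x) ∨
      (sbtw o z x ∧ sbtw o x y) := by
  constructor
  · intro h
    have hxy : x ≠ y := by rintro rfl; exact sbtw_irrefl_left h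
    have hyz : y ≠ z := by rintro rfl; exact sbtw_irrefl_right h
    have hzx : z ≠ x := by rintro rfl; exact sbtw_irrefl_left_right h
    rcases sbtw_or_sbtw_of_ne hx.symm hxy hy with h₁ | h₁ <;>
      rcases sbtw_or_sbtw_of_ne hy.symm hyz hz with h₂ | h₂ <;>
      rcases sbtw_or_sbtw_of_ne hz.symm hzx hx with h₃ | h₃ <;>
      first
      | exact .inl ⟨h₁, h₂⟩
      | exact .inr (.inl ⟨h₂, h₃⟩)
      | exact .inr (.inr ⟨h₃, h₁⟩)
      | exact absurd (sbtw_of_sbtw_of_sbtw h₂ h₁) h.not_sbtw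
      | exact absurd (sbtw_of_sbtw_of_sbtw h₃ h₂).cyclic_left h.not_sbtw
      | exact absurd (sbtw_of_sbtw_of_sbtw h₁ h₃).cyclic_right h.not_sbtw
  · rintro (⟨h₁, h₂⟩ | ⟨h₁, h₂⟩ | ⟨h₁, h₂⟩)
    exacts [sbtw_of_sbtw_of_sbtw h₁ h₂, (sbtw_of_sbtw_of_sbtw h₁ h₂).cyclic_right,
      (sbtw_of_sbtw_of_sbtw h₁ h₂).cyclic_left]

/-- Dense color classes meet every gap between finite sets, after cutting the circle at `o`. -/
theorem exists_color_between_finsets {σ : S → C}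
    (hcolor : ∀ a b : S, a ≠ b → ∀ t : C, ∃ c : S, sbtw a c b ∧ σ c = t) {o c : S} (hc : c ≠ o)
    {lo hi : Finset S} (hlo : ∀ l ∈ lo, l ≠ o) (hhi : ∀ h ∈ hi, h ≠ o)
    (hlt : ∀ l ∈ lo, ∀ h ∈ hi, sbtw o l h) (t : C) :
    ∃ b, b ≠ o ∧ (∀ l ∈ lo, sbtw o l b) ∧ (∀ h ∈ hi, sbtw o b h) ∧ σ b = t := by
  have hmax : lo.Nonempty → ∃ m ∈ lo, ∀ l ∈ lo, l = m ∨ sbtw o l m := fun hne =>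
    Finset.exists_greatest_of_rel (fun _ _ _ h₁ h₂ => h₁.trans_right h₂) hne fun x hx y hy => by
      by_cases hxy : x = y
      exacts [.inl hxy, .inr (sbtw_or_sbtw_of_ne (hlo x hx).symm hxy (hlo y hy))]
  have hmin : hi.Nonempty → ∃ n ∈ hi, ∀ h ∈ hi, h = n ∨ sbtw o n h := fun hne =>
    Finset.exists_greatest_of_rel (r := fun x y => sbtw o y x)
      (fun _ _ _ h₁ h₂ => h₂.trans_right h₁) hne fun x hx y hy => by
        by_cases hxy : x = y
        exacts [.inl hxy, .inr (sbtw_or_sbtw_of_ne (hhi x hx).symm hxy (hhi y hy)).symm]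
  rcases lo.eq_empty_or_nonempty with rfl | hlo' <;> rcases hi.eq_empty_or_nonempty with rfl | hhi'
  · obtain ⟨b, hb, hbt⟩ := hcolor o c hc.symm t
    exact ⟨b, by rintro rfl; exact sbtw_irrefl_left hb, by simp, by simp, hbt⟩
  · obtain ⟨n, hn, hn'⟩ := hmin hhi'
    obtain ⟨b, hb, hbt⟩ := hcolor o n (hhi n hn).symm t
    refine ⟨b, by rintro rfl; exact sbtw_irrefl_left hb, by simp, fun h hh => ?_, hbt⟩
    rcases hn' h hh with rfl | h'
    exacts [hb, hb.trans_right h']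
  · obtain ⟨m, hm, hm'⟩ := hmax hlo'
    obtain ⟨b, hb, hbt⟩ := hcolor m o (hlo m hm) t
    refine ⟨b, by rintro rfl; exact sbtw_irrefl_right hb, fun l hl => ?_, by simp, hbt⟩
    rcases hm' l hl with rfl | h'
    exacts [hb.cyclic_right, h'.trans_right hb.cyclic_right]
  · obtain ⟨m, hm, hm'⟩ := hmax hlo'
    obtain ⟨n, hn, hn'⟩ := hmin hhi'
    have hmn := hlt m hm n hn
    obtain ⟨b, hb, hbt⟩ := hcolor m n (by rintro rfl; exact sbtw_irrefl_right hmn) t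
    have hmb : sbtw o m b := (hb.trans_right hmn.cyclic_left).cyclic_right
    have hbn : sbtw o b n := hmn.trans_left hb
    refine ⟨b, by rintro rfl; exact sbtw_irrefl_left hbn, fun l hl => ?_, fun h hh => ?_, hbt⟩
    · rcases hm' l hl with rfl | h'
      exacts [hmb, h'.trans_right hmb]
    · rcases hn' h hh with rfl | hnh
      exacts [hbn, hbn.trans_right hnh]

/-- A finite set of pairs is a partial isomorphism of the colored circular order when matching
coordinates preserves equality, strict betweenness and color. -/
structure IsPartialIso (σ : S → C) (F : Finset (S × S)) : Prop where
  eq_iff : ∀ p ∈ F, ∀ q ∈ F, p.1 = q.1 ↔ p.2 = q.2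
  sbtw_iff : ∀ p ∈ F, ∀ q ∈ F, ∀ r ∈ F, sbtw p.1 q.1 r.1 ↔ sbtw p.2 q.2 r.2
  color_eq : ∀ p ∈ F, σ p.2 = σ p.1

namespace IsPartialIso

variable {σ : S → C} {F : Finset (S × S)}

theorem image_swap [DecidableEq S] (hF : IsPartialIso σ F) :
    IsPartialIso σ (F.image Prod.swap) where
  eq_iff := by
    simp only [Finset.forall_mem_image, Prod.fst_swap, Prod.snd_swap]
    exact fun p hp q hq => (hF.eq_iff p hp q hq).symm
  sbtw_iff := by
    simp only [Finset.forall_mem_image, Prod.fst_swap, Prod.snd_swap]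
    exact fun p hp q hq r hr => (hF.sbtw_iff p hp q hq r hr).symm
  color_eq := by
    simp only [Finset.forall_mem_image, Prod.fst_swap, Prod.snd_swap]
    exact fun p hp => (hF.color_eq p hp).symm

/-- It suffices to compare strict betweenness with the new point in the middle. -/
theorem insert [DecidableEq S] (hF : IsPartialIso σ F) {a b : S} (ha : ∀ p ∈ F, p.1 ≠ a)
    (hb : ∀ p ∈ F, p.2 ≠ b) (hab : ∀ p ∈ F, ∀ q ∈ F, sbtw p.1 a q.1 ↔ sbtw p.2 b q.2)
    (hσ : σ b = σ a) : IsPartialIso σ (insert (a, b) F) where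
  eq_iff := by
    simp only [Finset.forall_mem_insert]
    refine ⟨⟨by simp, fun q hq => ?_⟩, fun p hp => ⟨?_, hF.eq_iff p hp⟩⟩
    · simp [(ha q hq).symm, (hb q hq).symm]
    · simp [ha p hp, hb p hp]
  sbtw_iff := by
    have hab₁ : ∀ p ∈ F, ∀ q ∈ F, sbtw a p.1 q.1 ↔ sbtw b p.2 q.2 := fun p hp q hq => by
      rw [sbtw_cyclic, hab q hq p hp, ← sbtw_cyclic]
    have hab₂ : ∀ p ∈ F, ∀ q ∈ F, sbtw p.1 q.1 a ↔ sbtw p.2 q.2 b := fun p hp q hq => by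
      rw [sbtw_cyclic, hab₁ p hp q hq, ← sbtw_cyclic]
    simp only [Finset.forall_mem_insert, sbtw_irrefl_left, sbtw_irrefl_right,
      sbtw_irrefl_left_right, iff_self, implies_true, true_and]
    exact ⟨hab₁, fun p hp => ⟨hab p hp, fun q hq => ⟨hab₂ p hp q hq, hF.sbtw_iff p hp q hq⟩⟩⟩
  color_eq := by
    simp only [Finset.forall_mem_insert]
    exact ⟨hσ, hF.color_eq⟩

theorem exists_insert [DecidableEq S]
    (hcolor : ∀ a b : S, a ≠ b → ∀ t : C, ∃ c : S, sbtw a c b ∧ σ c = t)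
    (hF : IsPartialIso σ F) (a : S) : ∃ b, IsPartialIso σ (Insert.insert (a, b) F) := by
  by_cases ha : ∃ p ∈ F, p.1 = a
  · obtain ⟨⟨_, b⟩, hp, rfl⟩ := ha
    exact ⟨b, by rwa [Finset.insert_eq_of_mem hp]⟩
  push Not at ha
  rcases F.eq_empty_or_nonempty with rfl | ⟨o, ho⟩
  · exact ⟨a, hF.insert (by simp) (by simp) (by simp) rfl⟩
  classical
  have : Nontrivial S := ⟨_, _, ha o ho⟩
  obtain ⟨c, hc⟩ := exists_ne o.2
  have hne : ∀ p ∈ F, p.1 ≠ o.1 → p.2 ≠ o.2 := fun p hp => mt (hF.eq_iff p hp o ho).2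
  obtain ⟨b, hbo, hlo, hhi, hbσ⟩ := exists_color_between_finsets hcolor hc
    (lo := {p ∈ F | sbtw o.1 p.1 a}.image Prod.snd) (hi := {p ∈ F | sbtw o.1 a p.1}.image Prod.snd)
    (by
      simp only [Finset.forall_mem_image, Finset.mem_filter]
      exact fun p hp => hne p hp.1 fun h => sbtw_irrefl_left (h ▸ hp.2))
    (by
      simp only [Finset.forall_mem_image, Finset.mem_filter]
      exact fun p hp => hne p hp.1 fun h => sbtw_irrefl_left_right (h ▸ hp.2))
    (by
      simp only [Finset.forall_mem_image, Finset.mem_filter]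
      exact fun p hp q hq => (hF.sbtw_iff o ho p hp.1 q hq.1).1 (hp.2.trans_right hq.2)) (σ a)
  simp only [Finset.forall_mem_image, Finset.mem_filter, and_imp] at hlo hhi
  have hcases : ∀ p ∈ F, p.1 = o.1 ∨ sbtw o.1 p.1 a ∨ sbtw o.1 a p.1 := fun p hp => by
    by_cases hpo : p.1 = o.1
    exacts [.inl hpo, .inr (sbtw_or_sbtw_of_ne (Ne.symm hpo) (ha p hp) (ha o ho).symm)]
  have hb : ∀ p ∈ F, p.2 ≠ b := by
    rintro p hp rfl
    rcases hcases p hp with h | h | h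
    exacts [hbo ((hF.eq_iff p hp o ho).1 h), sbtw_irrefl_right (hlo hp h),
      sbtw_irrefl_right (hhi hp h)]
  have hlo' : ∀ p ∈ F, sbtw o.1 p.1 a ↔ sbtw o.2 p.2 b := fun p hp => by
    refine ⟨hlo hp, fun h => ?_⟩
    rcases hcases p hp with h' | h' | h'
    · exact absurd h ((hF.eq_iff p hp o ho).1 h' ▸ sbtw_irrefl_left)
    · exact h'
    · exact absurd (hhi hp h') h.cyclic_left.not_sbtw
  have hhi' : ∀ p ∈ F, sbtw o.1 a p.1 ↔ sbtw o.2 b p.2 := fun p hp => by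
    refine ⟨hhi hp, fun h => ?_⟩
    rcases hcases p hp with h' | h' | h'
    · exact absurd h ((hF.eq_iff p hp o ho).1 h' ▸ sbtw_irrefl_left_right)
    · exact absurd (hlo hp h') h.cyclic_left.not_sbtw
    · exact h'
  refine ⟨b, hF.insert ha hb (fun p hp q hq => ?_) hbσ⟩
  by_cases hpo : p.1 = o.1
  · rw [hpo, (hF.eq_iff p hp o ho).1 hpo, hhi' q hq]
  by_cases hqo : q.1 = o.1
  · rw [hqo, (hF.eq_iff q hq o ho).1 hqo, sbtw_cyclic, hlo' p hp, ← sbtw_cyclic]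
  rw [sbtw_iff_of_ne hpo (ha o ho).symm hqo, sbtw_iff_of_ne (hne p hp hpo) hbo (hne q hq hqo),
    hlo' p hp, hhi' q hq, hF.sbtw_iff o ho q hq p hp]

/-- Back and forth: a partial isomorphism extends to an automorphism. -/
theorem exists_equiv [Countable S]
    (hcolor : ∀ a b : S, a ≠ b → ∀ t : C, ∃ c : S, sbtw a c b ∧ σ c = t)
    (hF : IsPartialIso σ F) :
    ∃ g : S ≃ S, (∀ x y z, sbtw x y z ↔ sbtw (g x) (g y) (g z)) ∧ (∀ x, σ (g x) = σ x) ∧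
      ∀ p ∈ F, g p.1 = p.2 := by
  classical
  cases nonempty_encodable S
  let P := {G : Finset (S × S) // IsPartialIso σ G}
  let D : S ⊕ S → Order.Cofinal P := Sum.elim
    (fun a =>
      { carrier := {G | ∃ b, (a, b) ∈ G.1}
        isCofinal := fun G => by
          obtain ⟨b, hb⟩ := G.2.exists_insert hcolor a
          exact ⟨⟨_, hb⟩, ⟨b, Finset.mem_insert_self _ _⟩, Finset.subset_insert _ _⟩ })
    (fun b =>
      { carrier := {G | ∃ a, (a, b) ∈ G.1}
        isCofinal := fun G => by
          obtain ⟨a, ha⟩ := G.2.image_swap.exists_insert hcolor b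
          refine ⟨⟨_, ha.image_swap⟩, ⟨a, ?_⟩, fun p hp => ?_⟩
          · simp
          · exact Finset.mem_image.2 ⟨p.swap,
              Finset.mem_insert_of_mem (Finset.mem_image_of_mem _ hp), p.swap_swap⟩ })
  let I := Order.idealOfCofinals (⟨F, hF⟩ : P) D
  have hdir : ∀ {G H : P}, G ∈ I → H ∈ I → ∃ K ∈ I, G.1 ⊆ K.1 ∧ H.1 ⊆ K.1 :=
    fun hG hH => I.directed _ hG _ hH
  have hleft : ∀ a, ∃ b, ∃ G ∈ I, (a, b) ∈ G.1 := fun a => by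
    obtain ⟨G, ⟨b, hb⟩, hG⟩ := Order.cofinal_meets_idealOfCofinals (⟨F, hF⟩ : P) D (.inl a)
    exact ⟨b, G, hG, hb⟩
  have hright : ∀ b, ∃ a, ∃ G ∈ I, (a, b) ∈ G.1 := fun b => by
    obtain ⟨G, ⟨a, ha⟩, hG⟩ := Order.cofinal_meets_idealOfCofinals (⟨F, hF⟩ : P) D (.inr b)
    exact ⟨a, G, hG, ha⟩
  choose f u hu hf using hleft
  choose g v hv hg using hright
  have huniq : ∀ {p q : S × S} {G H : P}, G ∈ I → H ∈ I → p ∈ G.1 → q ∈ H.1 →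
      (p.1 = q.1 ↔ p.2 = q.2) := fun hG hH hp hq => by
    obtain ⟨K, -, hGK, hHK⟩ := hdir hG hH
    exact K.2.eq_iff _ (hGK hp) _ (hHK hq)
  refine ⟨⟨f, g, fun a => (huniq (hv _) (hu _) (hg _) (hf a)).2 rfl,
    fun b => (huniq (hu _) (hv _) (hf _) (hg b)).1 rfl⟩, fun x y z => ?_,
    fun x => (u x).2.color_eq _ (hf x), fun p hp => (huniq (hu p.1)
      (Order.mem_idealOfCofinals (⟨F, hF⟩ : P) D) (hf p.1) hp).1 rfl⟩
  obtain ⟨K, hK, hxK, hyK⟩ := hdir (hu x) (hu y)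
  obtain ⟨L, -, hKL, hzL⟩ := hdir hK (hu z)
  exact L.2.sbtw_iff _ (hKL (hxK (hf x))) _ (hKL (hyK (hf y))) _ (hzL (hf z))

end IsPartialIso

end CircularOrder

/-- Let `S` be a countable circularly ordered set whose strict
betweenness relation is everywhere dense, equipped with a coloring `σ : S → C`
by a nonempty finite set `C` such that each color class is dense.  Then `S` is
homogeneous: any isomorphism between finite subsets (a bijection preserving the
betweenness relation `btw` and the coloring) extends to an automorphism of the
colored circularly ordered set `S`. -/
theorem colored_circle_homogeneous {S C : Type} [Countable S] [CircularOrder S]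
    [Fintype C] [Nonempty C] (σ : S → C)
    (hdense : ∀ a b : S, a ≠ b → ∃ c : S, sbtw a c b)
    (hcolor : ∀ a b : S, a ≠ b → ∀ t : C, ∃ c : S, sbtw a c b ∧ σ c = t)
    (X Y : Set S) (hX : X.Finite) (hY : Y.Finite) (i : S → S)
    (hbij : Set.BijOn i X Y)
    (hbtw : ∀ x ∈ X, ∀ y ∈ X, ∀ z ∈ X, (btw x y z ↔ btw (i x) (i y) (i z)))
    (hcol : ∀ x ∈ X, σ (i x) = σ x) :
    ∃ g : S ≃ S, (∀ x y z : S, btw x y z ↔ btw (g x) (g y) (g z)) ∧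
      (∀ x : S, σ (g x) = σ x) ∧ ∀ x ∈ X, g x = i x := by
  classical
  have hF : CircularOrder.IsPartialIso σ (hX.toFinset.image fun x => (x, i x)) :=
    { eq_iff := by
        simp only [Finset.forall_mem_image, Set.Finite.mem_toFinset]
        exact fun x hx y hy => (hbij.injOn.eq_iff hx hy).symm
      sbtw_iff := by
        simp only [Finset.forall_mem_image, Set.Finite.mem_toFinset, sbtw_iff_not_btw]
        exact fun x hx y hy z hz => not_congr (hbtw z hz y hy x hx)
      color_eq := by
        simpa only [Finset.forall_mem_image, Set.Finite.mem_toFinset] using hcol }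
  obtain ⟨g, hg, hgσ, hgF⟩ := hF.exists_equiv hcolor
  refine ⟨g, fun x y z => ?_, hgσ, fun x hx => hgF (x, i x) (by simpa using hx)⟩
  rw [btw_iff_not_sbtw, btw_iff_not_sbtw, hg]
end

section
/- Let S be a countable set with a circular order whose strict betweenness relation sbtw is everywhere dense (for all a ≠ b in S there exists c with sbtw(a, c, b)), let Σ be a nonempty finite set, and let σ : S → Σ be a coloring such that each color class is dense (for all a ≠ b in S and every t ∈ Σ there exists c with sbtw(a, c, b) and σ(c) = t). Let G be the group of bijections g : S → S preserving btw and satisfying σ ∘ g = σ. Then for every n ≥ 0, the action of G on S^n has only finitely many orbits; that is, the quotient of S^n by the relation identifying tuples (x_1, …, x_n) and (g(x_1), …, g(x_n)) for g ∈ G is finite. -/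
/-- A coloring of a linear order is color-dense when every color occurs in every nonempty
open interval and above every point. -/
structure ColorDense {α C : Type*} [LinearOrder α] (σ : α → C) : Prop where
  exists_between : ∀ x y : α, x < y → ∀ t : C, ∃ c, x < c ∧ c < y ∧ σ c = t
  exists_gt : ∀ (x : α) (t : C), ∃ c, x < c ∧ σ c = t

theorem cmp_eq_cmp_of_le_iff_le {α β : Type*} [LinearOrder α] [LinearOrder β] {x y : α} {x' y' : β}
    (h : x ≤ y ↔ x' ≤ y') (h' : y ≤ x ↔ y' ≤ x') : cmp x y = cmp x' y' := by
  simp only [cmp, cmpUsing, ← not_le, h, h']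

/-- Finite partial order isomorphisms that preserve colors and match the bottom elements. -/
def ColorPartialIso {α β C : Type*} [LinearOrder α] [LinearOrder β] [OrderBot α] [OrderBot β]
    (σ : α → C) (τ : β → C) : Type _ :=
  { f : Finset (α × β) // (⊥, ⊥) ∈ f ∧ (∀ p ∈ f, σ p.1 = τ p.2) ∧
      ∀ p ∈ f, ∀ q ∈ f, cmp p.1 q.1 = cmp p.2 q.2 }

namespace ColorPartialIso

variable {α β C : Type*} [LinearOrder α] [LinearOrder β] [OrderBot α] [OrderBot β]
  {σ : α → C} {τ : β → C}

instance : Preorder (ColorPartialIso σ τ) := inferInstanceAs (Preorder (Subtype _))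

theorem exists_across (hτ : ColorDense τ) (f : ColorPartialIso σ τ) (a : α) :
    ∃ b : β, σ a = τ b ∧ ∀ p ∈ f.val, cmp p.1 a = cmp p.2 b := by
  classical
  obtain ⟨f, hbot, hcol, hcmp⟩ := f
  by_cases h : ∃ b, (a, b) ∈ f
  · obtain ⟨b, hb⟩ := h
    exact ⟨b, hcol _ hb, fun p hp => hcmp _ hp _ hb⟩
  have ha : (⊥ : α) < a := bot_lt_iff_ne_bot.2 fun h' => h ⟨⊥, h' ▸ hbot⟩
  obtain ⟨l, hl, hlmax⟩ := Finset.exists_max_image {p ∈ f | p.1 < a} Prod.snd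
    ⟨(⊥, ⊥), Finset.mem_filter.2 ⟨hbot, ha⟩⟩
  rw [Finset.mem_filter] at hl
  obtain ⟨b, hlb, hb, hbt⟩ : ∃ b, l.2 < b ∧ (∀ q ∈ f, a < q.1 → b < q.2) ∧ τ b = σ a := by
    by_cases hu : ({p ∈ f | a < p.1}).Nonempty
    · obtain ⟨u, hu, humin⟩ := Finset.exists_min_image {p ∈ f | a < p.1} Prod.snd hu
      rw [Finset.mem_filter] at hu
      obtain ⟨b, hlb, hbu, hbt⟩ := hτ.exists_between l.2 u.2
        ((lt_iff_lt_of_cmp_eq_cmp (hcmp _ hl.1 _ hu.1)).1 (hl.2.trans hu.2)) (σ a)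
      exact ⟨b, hlb, fun q hq haq => hbu.trans_le (humin q (Finset.mem_filter.2 ⟨hq, haq⟩)), hbt⟩
    · obtain ⟨b, hlb, hbt⟩ := hτ.exists_gt l.2 (σ a)
      exact ⟨b, hlb, fun q hq haq => (hu ⟨q, Finset.mem_filter.2 ⟨hq, haq⟩⟩).elim, hbt⟩
  refine ⟨b, hbt.symm, fun p hp => ?_⟩
  have hpa : p.1 ≠ a := fun he => h ⟨p.2, he ▸ hp⟩
  rcases lt_or_gt_of_ne hpa with hlt | hgt
  · rw [(cmp_eq_lt_iff _ _).2 hlt,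
      (cmp_eq_lt_iff _ _).2 ((hlmax p (Finset.mem_filter.2 ⟨hp, hlt⟩)).trans_lt hlb)]
  · rw [(cmp_eq_gt_iff _ _).2 hgt, (cmp_eq_gt_iff _ _).2 (hb p hp hgt)]

/-- The inverse of a partial isomorphism. -/
protected def comm (f : ColorPartialIso σ τ) : ColorPartialIso τ σ :=
  ⟨f.val.map (Equiv.prodComm α β).toEmbedding, by
    obtain ⟨f, hbot, hcol, hcmp⟩ := f
    simp only [Finset.mem_map_equiv, Equiv.prodComm_symm, Equiv.prodComm_apply]
    exact ⟨hbot, fun p hp => (hcol _ hp).symm, fun p hp q hq => (hcmp _ hp _ hq).symm⟩⟩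

theorem mem_comm {f : ColorPartialIso σ τ} {p : β × α} : p ∈ f.comm.val ↔ p.swap ∈ f.val := by
  simp [ColorPartialIso.comm, Finset.mem_map_equiv]

theorem exists_extend_left (hτ : ColorDense τ) (f : ColorPartialIso σ τ) (a : α) :
    ∃ g : ColorPartialIso σ τ, (∃ b, (a, b) ∈ g.val) ∧ f ≤ g := by
  classical
  obtain ⟨b, hab, hb⟩ := exists_across hτ f a
  refine ⟨⟨insert (a, b) f.val, Finset.mem_insert_of_mem f.prop.1, fun p hp => ?_,
    fun p hp q hq => ?_⟩, ⟨b, Finset.mem_insert_self _ _⟩, Finset.subset_insert _ _⟩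
  · rcases Finset.mem_insert.1 hp with rfl | hp
    · exact hab
    · exact f.prop.2.1 p hp
  · rw [Finset.mem_insert] at hp hq
    rcases hp with (rfl | pf) <;> rcases hq with (rfl | qf)
    · simp only [cmp_self_eq_eq]
    · rw [cmp_eq_cmp_symm]
      exact hb _ qf
    · exact hb _ pf
    · exact f.prop.2.2 _ pf _ qf

theorem exists_extend_right (hσ : ColorDense σ) (f : ColorPartialIso σ τ) (b : β) :
    ∃ g : ColorPartialIso σ τ, (∃ a, (a, b) ∈ g.val) ∧ f ≤ g := by
  obtain ⟨g, ⟨a, ha⟩, hfg⟩ := exists_extend_left hσ f.comm b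
  exact ⟨g.comm, ⟨a, mem_comm.2 ha⟩, fun p hp => mem_comm.2 (hfg (mem_comm.2 hp))⟩

/-- Back and forth: a finite partial isomorphism between countable color-dense linear orders
extends to a color-preserving order isomorphism. -/
theorem exists_orderIso [Countable α] [Countable β] (hσ : ColorDense σ) (hτ : ColorDense τ)
    (f : ColorPartialIso σ τ) :
    ∃ e : α ≃o β, (∀ a, τ (e a) = σ a) ∧ ∀ p ∈ f.val, e p.1 = p.2 := by
  cases nonempty_encodable α
  cases nonempty_encodable β
  let D : α ⊕ β → Order.Cofinal (ColorPartialIso σ τ) := Sum.elim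
    (fun a => ⟨{g | ∃ b, (a, b) ∈ g.val}, fun g => exists_extend_left hτ g a⟩)
    (fun b => ⟨{g | ∃ a, (a, b) ∈ g.val}, fun g => exists_extend_right hσ g b⟩)
  let I : Order.Ideal (ColorPartialIso σ τ) := Order.idealOfCofinals f D
  have hF : ∀ a, ∃ b, ∃ g ∈ I, (a, b) ∈ g.val := fun a => by
    obtain ⟨g, ⟨b, hb⟩, hg⟩ := Order.cofinal_meets_idealOfCofinals f D (Sum.inl a)
    exact ⟨b, g, hg, hb⟩
  have hG : ∀ b, ∃ a, ∃ g ∈ I, (a, b) ∈ g.val := fun b => by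
    obtain ⟨g, ⟨a, ha⟩, hg⟩ := Order.cofinal_meets_idealOfCofinals f D (Sum.inr b)
    exact ⟨a, g, hg, ha⟩
  have hcmp : ∀ p q : α × β, (∃ g ∈ I, p ∈ g.val) → (∃ g ∈ I, q ∈ g.val) →
      cmp p.1 q.1 = cmp p.2 q.2 := by
    rintro p q ⟨g, hg, hp⟩ ⟨g', hg', hq⟩
    obtain ⟨m, _, hm, hm'⟩ := I.directed _ hg _ hg'
    exact m.prop.2.2 p (hm hp) q (hm' hq)
  choose F hF using hF
  choose G hG using hG
  refine ⟨OrderIso.ofCmpEqCmp F G fun a b => hcmp (a, F a) (G b, b) (hF a) (hG b),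
    fun a => ?_, fun p hp => ?_⟩
  · obtain ⟨g, _, hg⟩ := hF a
    exact (g.prop.2.1 _ hg).symm
  · have := hcmp (p.1, F p.1) p (hF p.1) ⟨f, Order.mem_idealOfCofinals f D, hp⟩
    simp only [cmp_self_eq_eq] at this
    exact (cmp_eq_eq_iff _ _).1 this.symm

end ColorPartialIso

/-- The circularly ordered set `S` cut open at the point `p`, which becomes the least element. -/
def CircularCut {S : Type*} (_p : S) : Type _ := S

namespace CircularCut

variable {S : Type*} [CircularOrder S] {p : S}

noncomputable instance : LinearOrder (CircularCut p) where
  le x y := x = y ∨ x = p ∨ sbtw (α := S) p x y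
  le_refl x := Or.inl rfl
  le_trans (x y z : S) := by
    rintro (rfl | hx | hxy) (hyz | hy | hyz)
    · exact Or.inl hyz
    · exact Or.inr (Or.inl hy)
    · exact Or.inr (Or.inr hyz)
    · exact Or.inr (Or.inl hx)
    · exact Or.inr (Or.inl hx)
    · exact Or.inr (Or.inl hx)
    · exact Or.inr (Or.inr (hyz ▸ hxy))
    · exact (sbtw_irrefl_left_right (hy ▸ hxy : sbtw p x p)).elim
    · exact Or.inr (Or.inr (sbtw_trans_right hxy hyz))
  le_antisymm (x y : S) := by
    rintro (h | hx | hxy) (h' | hy | hyx)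
    · exact h
    · exact h
    · exact h
    · exact h'.symm
    · exact hx.trans hy.symm
    · exact (sbtw_irrefl_left_right (hx ▸ hyx : sbtw p y p)).elim
    · exact h'.symm
    · exact (sbtw_irrefl_left_right (hy ▸ hxy : sbtw p x p)).elim
    · exact (hxy.not_btw hyx.btw.cyclic_left).elim
  le_total (x y : S) := by
    by_cases hxy : x = y
    · exact Or.inl (Or.inl hxy)
    by_cases hx : x = p
    · exact Or.inl (Or.inr (Or.inl hx))
    by_cases hy : y = p
    · exact Or.inr (Or.inr (Or.inl hy))
    by_cases h : sbtw p x y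
    · exact Or.inl (Or.inr (Or.inr h))
    · refine Or.inr (Or.inr (Or.inr (sbtw_iff_not_btw.2 fun h' => ?_)))
      rcases h'.antisymm (btw_iff_not_sbtw.2 fun h'' => h h''.cyclic_right) with h | h | h
      · exact hxy h
      · exact hy h
      · exact hx h.symm
  toDecidableLE := Classical.decRel _

instance : OrderBot (CircularCut p) where
  bot := p
  bot_le _ := Or.inr (Or.inl rfl)

theorem le_iff {x y : CircularCut p} : x ≤ y ↔ x = y ∨ x = ⊥ ∨ sbtw (α := S) p x y := Iff.rfl

theorem lt_of_sbtw {x y : CircularCut p} (h : sbtw (α := S) p x y) : x < y :=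
  lt_of_le_of_ne (Or.inr (Or.inr h)) (by rintro rfl; exact sbtw_irrefl_right h)

theorem sbtw_of_bot_lt_of_lt {x y : CircularCut p} (hx : ⊥ < x) (hxy : x < y) :
    sbtw (α := S) p x y := by
  rcases le_iff.1 hxy.le with h | h | h
  · exact (hxy.ne h).elim
  · exact (hx.ne' h).elim
  · exact h

theorem sbtw_of_lt_of_lt {x y z : CircularCut p} (hxy : x < y) (hyz : y < z) :
    sbtw (α := S) x y z := by
  have h := sbtw_of_bot_lt_of_lt (bot_le.trans_lt hxy) hyz
  rcases eq_bot_or_bot_lt x with hx | hx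
  · rw [hx]
    exact h
  · exact (h.cyclic_right.trans_left (sbtw_of_bot_lt_of_lt hx hxy)).cyclic_left

theorem sbtw_iff {x y z : CircularCut p} : sbtw (α := S) x y z ↔
    x < y ∧ y < z ∨ y < z ∧ z < x ∨ z < x ∧ x < y := by
  constructor
  · intro h
    have hxy : x ≠ y := by rintro rfl; exact sbtw_irrefl_left h
    have hyz : y ≠ z := by rintro rfl; exact sbtw_irrefl_right h
    have hxz : x ≠ z := by rintro rfl; exact sbtw_irrefl_left_right h
    have hn : ¬ sbtw (α := S) z y x := fun h' => h.not_btw h'.btw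
    rcases lt_or_gt_of_ne hxy with h1 | h1 <;> rcases lt_or_gt_of_ne hyz with h2 | h2
    · exact Or.inl ⟨h1, h2⟩
    · rcases lt_or_gt_of_ne hxz with h3 | h3
      · exact (hn (sbtw_of_lt_of_lt h3 h2).cyclic_left).elim
      · exact Or.inr (Or.inr ⟨h3, h1⟩)
    · rcases lt_or_gt_of_ne hxz with h3 | h3
      · exact (hn (sbtw_of_lt_of_lt h1 h3).cyclic_right).elim
      · exact Or.inr (Or.inl ⟨h2, h3⟩)
    · exact (hn (sbtw_of_lt_of_lt h2 h1)).elim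
  · rintro (⟨h1, h2⟩ | ⟨h1, h2⟩ | ⟨h1, h2⟩)
    · exact sbtw_of_lt_of_lt h1 h2
    · exact (sbtw_of_lt_of_lt h1 h2).cyclic_right
    · exact (sbtw_of_lt_of_lt h1 h2).cyclic_left

theorem btw_orderIso_iff {q : S} (e : CircularCut p ≃o CircularCut q) (x y z : CircularCut p) :
    btw (α := S) x y z ↔ btw (α := S) (e x) (e y) (e z) := by
  have h : sbtw (α := S) z y x ↔ sbtw (α := S) (e z) (e y) (e x) := by
    refine sbtw_iff.trans (Iff.trans ?_ sbtw_iff.symm)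
    simp only [e.lt_iff_lt]
  exact btw_iff_not_sbtw.trans ((not_congr h).trans btw_iff_not_sbtw.symm)

theorem colorDense [Nontrivial S] {C : Type*} {σ : S → C}
    (hcolor : ∀ a b : S, a ≠ b → ∀ t : C, ∃ c : S, sbtw a c b ∧ σ c = t) :
    ColorDense (α := CircularCut p) σ where
  exists_between x y hxy t := by
    obtain ⟨c, hc, hct⟩ := hcolor x y hxy.ne t
    rcases eq_bot_or_bot_lt x with hx | hx
    · rw [hx] at hc ⊢
      exact ⟨c, bot_lt_iff_ne_bot.2 (fun h => sbtw_irrefl_left (h ▸ hc : sbtw p p _)),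
        lt_of_sbtw hc, hct⟩
    · have h := sbtw_of_bot_lt_of_lt hx hxy
      exact ⟨c, lt_of_sbtw (sbtw_trans_right hc h.cyclic_left).cyclic_right,
        lt_of_sbtw (h.trans_left hc), hct⟩
  exists_gt x t := by
    rcases eq_bot_or_bot_lt x with hx | hx
    · rw [hx]
      obtain ⟨y, hy⟩ := exists_ne p
      obtain ⟨c, hc, hct⟩ := hcolor p y hy.symm t
      exact ⟨c, bot_lt_iff_ne_bot.2 (fun h => sbtw_irrefl_left (h ▸ hc : sbtw p p _)), hct⟩
    · obtain ⟨c, hc, hct⟩ := hcolor x p hx.ne' t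
      exact ⟨c, lt_of_sbtw hc.cyclic_right, hct⟩

end CircularCut

/-- Tuples in a countable, densely colored circular order with the same equality pattern, strict
betweenness pattern and colors are related by an automorphism. -/
theorem exists_circular_automorphism {S C : Type*} [Countable S] [Nontrivial S] [CircularOrder S]
    {σ : S → C} (hcolor : ∀ a b : S, a ≠ b → ∀ t : C, ∃ c : S, sbtw a c b ∧ σ c = t)
    {n : ℕ} {v w : Fin n → S} (heq : ∀ i j, v i = v j ↔ w i = w j)
    (hsbtw : ∀ i j k, sbtw (v i) (v j) (v k) ↔ sbtw (w i) (w j) (w k))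
    (hσ : ∀ i, σ (v i) = σ (w i)) :
    ∃ g : S ≃ S, (∀ x y z : S, btw x y z ↔ btw (g x) (g y) (g z)) ∧
      (∀ x : S, σ (g x) = σ x) ∧ ∀ i : Fin n, g (v i) = w i := by
  classical
  obtain _ | n := n
  · exact ⟨Equiv.refl S, fun _ _ _ => Iff.rfl, fun _ => rfl, fun i => i.elim0⟩
  have : Countable (CircularCut (v 0)) := ‹Countable S›
  have : Countable (CircularCut (w 0)) := ‹Countable S›
  have hle : ∀ i j, @LE.le (CircularCut (v 0)) _ (v i) (v j) ↔
      @LE.le (CircularCut (w 0)) _ (w i) (w j) := fun i j =>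
    or_congr (heq i j) (or_congr (heq i 0) (hsbtw 0 i j))
  let f : ColorPartialIso (α := CircularCut (v 0)) (β := CircularCut (w 0)) σ σ :=
    ⟨Finset.univ.image fun i => (v i, w i), Finset.mem_image.2 ⟨0, Finset.mem_univ _, rfl⟩, by
      simp only [Finset.mem_image, Finset.mem_univ, true_and]
      rintro _ ⟨i, rfl⟩
      exact hσ i, by
      simp only [Finset.mem_image, Finset.mem_univ, true_and]
      rintro _ ⟨i, rfl⟩ _ ⟨j, rfl⟩
      exact cmp_eq_cmp_of_le_iff_le (hle i j) (hle j i)⟩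
  obtain ⟨e, he, hf⟩ := f.exists_orderIso (CircularCut.colorDense hcolor)
    (CircularCut.colorDense hcolor)
  exact ⟨e.toEquiv, CircularCut.btw_orderIso_iff e, he, fun i =>
    hf (v i, w i) (Finset.mem_image.2 ⟨i, Finset.mem_univ _, rfl⟩)⟩

/-- Let `S` be a countable circularly ordered set whose strict
betweenness relation is everywhere dense, equipped with a coloring `σ : S → C`
by a nonempty finite set `C` such that each color class is dense, and let `G` be
the group of automorphisms of the colored circularly ordered set `S`.  Then for
every `n`, the action of `G` on `Sⁿ` has finitely many orbits: the quotient of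
`Sⁿ` by the relation identifying `v` with `g ∘ v` for an automorphism `g` is
finite. -/
theorem colored_circle_oligomorphic {S C : Type} [Countable S] [CircularOrder S]
    [Fintype C] [Nonempty C] (σ : S → C)
    (hdense : ∀ a b : S, a ≠ b → ∃ c : S, sbtw a c b)
    (hcolor : ∀ a b : S, a ≠ b → ∀ t : C, ∃ c : S, sbtw a c b ∧ σ c = t)
    (n : ℕ) :
    Finite (Quot (fun v w : Fin n → S => ∃ g : S ≃ S,
      (∀ x y z : S, btw x y z ↔ btw (g x) (g y) (g z)) ∧
      (∀ x : S, σ (g x) = σ x) ∧ ∀ i : Fin n, g (v i) = w i)) := by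
  rcases subsingleton_or_nontrivial S with hS | hS
  · infer_instance
  let pattern (v : Fin n → S) :
      (Fin n → Fin n → Prop) × (Fin n → Fin n → Fin n → Prop) × (Fin n → C) :=
    (fun i j => v i = v j, fun i j k => sbtw (v i) (v j) (v k), fun i => σ (v i))
  refine Finite.of_injective (fun q => pattern q.out) fun q r h => ?_
  simp only [pattern, Prod.mk.injEq, funext_iff, eq_iff_iff] at h
  rw [← Quot.out_eq q, ← Quot.out_eq r]
  exact Quot.sound (exists_circular_automorphism hcolor h.1 h.2.1 h.2.2)
end
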